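/- For every positive integer d there exists ε > 0 such that for every δ > 0 there exists a positive integer k with the following property: for all positive integers n_1,…,n_d, every submultiset ℬ' ⊆ ℬ with |ℬ'| ≥ δ|ℬ|, and every nonempty subset 𝒜 ⊆ 𝒢 that is (ℬ',1−ε)-closed, there exists a k-simple set 𝒟 ⊆ 𝒢 such that |𝒟 ∩ 𝒜| ≥ (1/2)|𝒟|. -/

import Mathlib

open Finset

/-- The space of `d`-tuples `(u_1, …, u_d)` with `u_i ∈ F_2^{n_i}`. -/
abbrev Tup (d : ℕ) (n : Fin d → ℕ) := (i : Fin d) → (Fin (n i) → ZMod 2)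

/-- `𝒢 = F_2^{n_1} ⊗ ⋯ ⊗ F_2^{n_d}`, realized as `d`-dimensional arrays. -/
abbrev Arr (d : ℕ) (n : Fin d → ℕ) := ((i : Fin d) → Fin (n i)) → ZMod 2

/-- The rank-one tensor `u_1 ⊗ ⋯ ⊗ u_d`. -/
def tensorOf (d : ℕ) (n : Fin d → ℕ) (u : Tup d n) : Arr d n :=
  fun x => ∏ i, u i (x i)

/-- `F_2^I = ⊗_{i ∈ I} F_2^{n_i}`, realized as arrays indexed by coordinates in `I`. -/
abbrev F2I (d : ℕ) (n : Fin d → ℕ) (I : Finset (Fin d)) :=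
  ((i : {x : Fin d // x ∈ I}) → Fin (n i.1)) → ZMod 2

/-- The `I`-arrSlice of an array `r`, obtained by fixing the coordinates outside `I` to be `z`. -/
def arrSlice (d : ℕ) (n : Fin d → ℕ) (I : Finset (Fin d)) (r : Arr d n)
    (z : (i : {x : Fin d // x ∉ I}) → Fin (n i.1)) : F2I d n I :=
  fun y => r (fun i => if h : i ∈ I then y ⟨i, h⟩ else z ⟨i, h⟩)

/-- The subspace `H ⊗ F_2^{I^c}` of `𝒢`: arrays all of whose `I`-slices lie in `H`. -/
def cylSub (d : ℕ) (n : Fin d → ℕ) (I : Finset (Fin d))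
    (H : Submodule (ZMod 2) (F2I d n I)) : Submodule (ZMod 2) (Arr d n) where
  carrier := {r | ∀ z, arrSlice d n I r z ∈ H}
  add_mem' := fun ha hb z => H.add_mem (ha z) (hb z)
  zero_mem' := fun z => H.zero_mem
  smul_mem' := fun c _ hr z => H.smul_mem c (hr z)

/-- A subset of `𝒢` is `k`-simple if it is a translate of `⋂_{∅ ≠ I ⊆ [d]} (H_I ⊗ F_2^{I^c})`
for subspaces `H_I ⊆ F_2^I` of codimension at most `k`. -/
def IsKSimple (d : ℕ) (n : Fin d → ℕ) (k : ℕ) (D : Set (Arr d n)) : Prop :=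
  ∃ t : Arr d n, ∃ H : (I : Finset (Fin d)) → Submodule (ZMod 2) (F2I d n I),
    (∀ I : Finset (Fin d), I.Nonempty →
      Module.finrank (ZMod 2) (F2I d n I) - Module.finrank (ZMod 2) (H I) ≤ k) ∧
    D = {x | ∃ r : Arr d n,
      (∀ I : Finset (Fin d), I.Nonempty → r ∈ cylSub d n I (H I)) ∧ x = t + r}

/-- The number of pairs `(a, u) ∈ 𝒜 × ℬ'` with `a + u_1 ⊗ ⋯ ⊗ u_d ∈ 𝒜`. -/
def closedCnt (d : ℕ) (n : Fin d → ℕ) (A : Finset (Arr d n)) (B' : Finset (Tup d n)) : ℕ :=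
  ((A ×ˢ B').filter (fun p => p.1 + tensorOf d n p.2 ∈ A)).card


namespace TP

open scoped BigOperators
open Function

set_option linter.unusedSectionVars false
set_option linter.unusedVariables false

/-- sign -/
def sg (a : ZMod 2) : ℝ := if a = 0 then 1 else -1

lemma zmod2_cases (a : ZMod 2) : a = 0 ∨ a = 1 := by
  revert a; decide

lemma sg_zero : sg 0 = 1 := by simp [sg]
lemma sg_one : sg 1 = -1 := by simp [sg]

lemma sg_add (a b : ZMod 2) : sg (a + b) = sg a * sg b := by
  rcases zmod2_cases a with rfl | rfl <;> rcases zmod2_cases b with rfl | rfl <;>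
    simp [sg_zero, sg_one]
  have : (1 : ZMod 2) + 1 = 0 := by decide
  rw [this, sg_zero]

lemma sg_sum {α : Type*} (s : Finset α) (f : α → ZMod 2) :
    sg (∑ a ∈ s, f a) = ∏ a ∈ s, sg (f a) := by
  classical
  induction s using Finset.induction_on with
  | empty => simp [sg_zero]
  | insert a s ha ih => rw [sum_insert ha, prod_insert ha, sg_add, ih]

lemma sg_abs (a : ZMod 2) : |sg a| = 1 := by
  rcases zmod2_cases a with rfl | rfl <;> simp [sg_zero, sg_one]

lemma sg_sq (a : ZMod 2) : sg a * sg a = 1 := by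
  rcases zmod2_cases a with rfl | rfl <;> simp [sg_zero, sg_one]

lemma zmod2_add_self (a : ZMod 2) : a + a = 0 := by
  revert a; decide

lemma fun_add_self {β : Type*} (a : β → ZMod 2) : a + a = 0 := by
  funext x; exact zmod2_add_self _

/-- product spaces -/
abbrev XX {ι : Type} (n : ι → ℕ) := (i : ι) → (Fin (n i) → ZMod 2)

variable {ι : Type} [Fintype ι] [DecidableEq ι] {n : ι → ℕ}

lemma xx_add_self (x : XX n) : x + x = 0 := by
  funext i; exact fun_add_self _

structure IsForm (I : Finset ι) (f : XX n → ZMod 2) : Prop where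
  dep : ∀ x y : XX n, (∀ i ∈ I, x i = y i) → f x = f y
  add : ∀ i ∈ I, ∀ (x : XX n) (a b : Fin (n i) → ZMod 2),
    f (update x i (a + b)) = f (update x i a) + f (update x i b)

lemma IsForm.zero (I : Finset ι) : IsForm (n := n) I 0 :=
  ⟨fun _ _ _ => rfl, fun _ _ _ _ _ => by simp⟩

lemma IsForm.fadd {I : Finset ι} {f g : XX n → ZMod 2} (hf : IsForm I f) (hg : IsForm I g) :
    IsForm I (f + g) :=
  ⟨fun x y h => by simp [hf.dep x y h, hg.dep x y h], fun i hi x a b => by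
    simp only [Pi.add_apply, hf.add i hi, hg.add i hi]; ring⟩

lemma IsForm.sum {α : Type*} {I : Finset ι} (s : Finset α) (f : α → XX n → ZMod 2)
    (h : ∀ a ∈ s, IsForm I (f a)) : IsForm I (∑ a ∈ s, f a) := by
  classical
  induction s using Finset.induction_on with
  | empty => simpa using IsForm.zero I
  | insert a s ha ih =>
    rw [sum_insert ha]
    exact (h a (mem_insert_self _ _)).fadd (ih fun b hb => h b (mem_insert_of_mem hb))

lemma IsForm.smul {I : Finset ι} {f : XX n → ZMod 2} (hf : IsForm I f) (c : ZMod 2) :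
    IsForm I (c • f) := by
  rcases zmod2_cases c with rfl | rfl
  · simpa using IsForm.zero I
  · simpa using hf

lemma IsForm.mul {I J : Finset ι} {f g : XX n → ZMod 2} (hf : IsForm I f) (hg : IsForm J g)
    (hIJ : Disjoint I J) : IsForm (I ∪ J) (f * g) := by
  refine ⟨fun x y h => ?_, fun i hi x a b => ?_⟩
  · simp [hf.dep x y fun i hi => h i (mem_union_left _ hi),
      hg.dep x y fun i hi => h i (mem_union_right _ hi)]
  · have key : ∀ {I' J' : Finset ι} {f' g' : XX n → ZMod 2}, IsForm I' f' → IsForm J' g' →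
        Disjoint I' J' → i ∈ I' → f' (update x i (a + b)) * g' (update x i (a + b)) =
          f' (update x i a) * g' (update x i a) + f' (update x i b) * g' (update x i b) := by
      intro I' J' f' g' hf' hg' hd hi'
      have hgg : ∀ u v, g' (update x i u) = g' (update x i v) := fun u v => by
        apply hg'.dep
        intro j hj
        have : j ≠ i := by
          rintro rfl; exact (Finset.disjoint_left.mp hd hi' hj)
        simp [update_of_ne this]
      rw [hf'.add i hi', hgg (a + b) a, hgg b a]; ring
    rcases mem_union.mp hi with h | h
    · exact key hf hg hIJ h
    · have := key hg hf hIJ.symm h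
      simp only [Pi.mul_apply]
      rw [mul_comm, this]; ring

/-- cube formula -/
lemma sum_powerset_insert' {M : Type*} [AddCommMonoid M] {α : Type*} [DecidableEq α]
    {s : Finset α} {i : α} (hi : i ∉ s) (f : Finset α → M) :
    ∑ ω ∈ (insert i s).powerset, f ω = ∑ ω ∈ s.powerset, f ω + ∑ ω ∈ s.powerset, f (insert i ω) :=
  Finset.sum_powerset_insert hi f

lemma cube_indep {K : Finset ι} {i : ι} (hi : i ∈ K) (g : XX n → ZMod 2)
    (hg : ∀ (x : XX n) a, g (update x i a) = g x) (x y : XX n) :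
    ∑ ω ∈ K.powerset, g (ω.piecewise y x) = 0 := by
  rw [← insert_erase hi, sum_powerset_insert' (notMem_erase i K)]
  have : ∀ ω ∈ (K.erase i).powerset, g ((insert i ω).piecewise y x) = g (ω.piecewise y x) := by
    intro ω _
    rw [piecewise_insert, hg]
  rw [sum_congr rfl this, zmod2_add_self]

lemma cube_sub {K : Finset ι} {f : XX n → ZMod 2} (hf : IsForm K f) (s : Finset ι) (hs : s ⊆ K)
    (x y : XX n) :
    ∑ ω ∈ s.powerset, f (ω.piecewise y x) = f (s.piecewise (x + y) x) := by
  induction s using Finset.induction_on generalizing x with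
  | empty => simp
  | insert i s hi ih =>
    have hiK := hs (mem_insert_self i s)
    have hsK : s ⊆ K := fun j hj => hs (mem_insert_of_mem hj)
    rw [sum_powerset_insert' hi, ih hsK]
    have h2 : ∀ ω ∈ s.powerset, f ((insert i ω).piecewise y x) =
        f (ω.piecewise y (update x i (y i))) := by
      intro ω hω
      have : i ∉ ω := fun h => hi (mem_powerset.mp hω h)
      rw [piecewise_insert, update_piecewise_of_notMem _ _ _ this]
    rw [sum_congr rfl h2, ih hsK, piecewise_insert]
    have e1 : s.piecewise (x + y) x = update (s.piecewise (x + y) x) i (x i) := by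
      have : x i = (s.piecewise (x + y) x) i := by simp [hi]
      rw [this, update_eq_self]
    have e2 : s.piecewise (update x i (y i) + y) (update x i (y i)) =
        update (s.piecewise (x + y) x) i (y i) := by
      funext j
      by_cases hj : j = i
      · subst hj; simp [hi]
      · by_cases hjs : j ∈ s <;> simp [hj, hjs, piecewise]
    rw [e2, e1]
    simp only [update_idem]
    exact (hf.add i hiK _ _ _).symm

lemma cube_form {K : Finset ι} {f : XX n → ZMod 2} (hf : IsForm K f) (x y : XX n) :
    ∑ ω ∈ K.powerset, f (ω.piecewise y x) = f (x + y) := by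
  rw [cube_sub hf K (Subset.refl _)]
  apply hf.dep
  intro i hi
  simp [hi]

/-! expectations -/

lemma ex_update (i : ι) (φ : XX n → ℝ) :
    𝔼 x : XX n, 𝔼 t : Fin (n i) → ZMod 2, φ (update x i t) = 𝔼 x, φ x := by
  have h1 : 𝔼 x : XX n, 𝔼 t : Fin (n i) → ZMod 2, φ (update x i t) =
      𝔼 p : XX n × (Fin (n i) → ZMod 2), φ (update p.1 i p.2) := by
    rw [← univ_product_univ, expect_product]
  have h2 : 𝔼 x : XX n, φ x = 𝔼 p : XX n × (Fin (n i) → ZMod 2), φ p.1 := by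
    rw [← univ_product_univ, expect_product]
    simp
  rw [h1, h2]
  refine Fintype.expect_bijective (fun p => (update p.1 i p.2, p.1 i)) ?_ _ _ (fun p => rfl)
  refine Involutive.bijective ?_
  rintro ⟨x, t⟩
  simp

lemma ex_cs (i : ι) (φ : XX n → ℝ) :
    (𝔼 x, φ x) ^ 2 ≤ 𝔼 x : XX n, 𝔼 t : Fin (n i) → ZMod 2, φ x * φ (update x i t) := by
  set ψ : XX n → ℝ := fun x => 𝔼 t : Fin (n i) → ZMod 2, φ (update x i t) with hψ
  have h1 : 𝔼 x, φ x = 𝔼 x, ψ x := (ex_update i φ).symm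
  have h2 : 𝔼 x : XX n, 𝔼 t : Fin (n i) → ZMod 2, φ x * φ (update x i t) = 𝔼 x, ψ x ^ 2 := by
    have : ∀ x, 𝔼 t : Fin (n i) → ZMod 2, φ x * φ (update x i t) = φ x * ψ x := fun x => by
      rw [hψ, ← mul_expect]
    simp_rw [this]
    rw [← ex_update i]
    apply expect_congr rfl
    intro x _
    have : ∀ t, ψ (update x i t) = ψ x := fun t => by simp [hψ]
    simp_rw [this]
    rw [← expect_mul, sq]
  rw [h1, h2]
  have := expect_mul_sq_le_sq_mul_sq (univ : Finset (XX n)) ψ (fun _ => 1)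
  simpa using this

lemma cs_iter (F : XX n → ZMod 2) (s : Finset ι) :
    (|𝔼 x, sg (F x)| ^ (2 ^ s.card) ≤
      |𝔼 y : XX n, 𝔼 x : XX n, sg (∑ ω ∈ s.powerset, F (ω.piecewise y x))|) ∧ (s.Nonempty →
      0 ≤ 𝔼 y : XX n, 𝔼 x : XX n, sg (∑ ω ∈ s.powerset, F (ω.piecewise y x))) := by
  induction s using Finset.induction_on with
  | empty =>
    simp
  | insert i s hi ih =>
    have ih := ih.1
    suffices hsuff : |𝔼 x, sg (F x)| ^ (2 ^ (insert i s).card) ≤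
      𝔼 y : XX n, 𝔼 x : XX n, sg (∑ ω ∈ (insert i s).powerset, F (ω.piecewise y x)) by
      have h0 : 0 ≤ |𝔼 x, sg (F x)| ^ (2 ^ (insert i s).card) := by positivity
      exact ⟨hsuff.trans (le_abs_self _), fun _ => h0.trans hsuff⟩
    rw [card_insert_of_notMem hi, pow_succ, pow_mul]
    set H : XX n → XX n → ZMod 2 := fun y x => ∑ ω ∈ s.powerset, F (ω.piecewise y x) with hH
    have e : ∀ y x : XX n, ∑ ω ∈ (insert i s).powerset, F (ω.piecewise y x) =
        H y x + H y (update x i (y i)) := by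
      intro y x
      rw [sum_powerset_insert' hi]
      congr 1
      apply sum_congr rfl
      intro ω hω
      have : i ∉ ω := fun h => hi (mem_powerset.mp hω h)
      rw [piecewise_insert, update_piecewise_of_notMem _ _ _ this]
    simp_rw [e, sg_add]
    have h1 : (|𝔼 x, sg (F x)| ^ 2 ^ s.card) ^ 2 ≤ (𝔼 y, 𝔼 x, sg (H y x)) ^ 2 := by
      rw [← sq_abs (𝔼 y, 𝔼 x, sg (H y x))]
      exact pow_le_pow_left₀ (by positivity) ih 2
    refine h1.trans ?_
    have h2 : (𝔼 y, 𝔼 x, sg (H y x)) ^ 2 ≤ 𝔼 y, (𝔼 x, sg (H y x)) ^ 2 := by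
      have := expect_mul_sq_le_sq_mul_sq (univ : Finset (XX n)) (fun y => 𝔼 x, sg (H y x))
        (fun _ => 1)
      simpa using this
    refine h2.trans ?_
    refine (expect_le_expect (fun y _ => ex_cs i (fun x => sg (H y x)))).trans (le_of_eq ?_)
    rw [← ex_update i (fun y => 𝔼 x, sg (H y x) * sg (H y (update x i (y i))))]
    apply expect_congr rfl
    intro y _
    have hHy : ∀ t x, H (update y i t) x = H y x := by
      intro t x
      apply sum_congr rfl
      intro ω hω
      have : i ∉ ω := fun h => hi (mem_powerset.mp hω h)
      congr 1
      refine piecewise_congr _ (fun j hj => ?_) fun _ _ => rfl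
      rw [update_of_ne]; rintro rfl; exact this hj
    simp_rw [hHy]
    rw [expect_comm]
    simp

lemma cs_main {α : Type*} (K : Finset ι) (hK : K.Nonempty) (f : XX n → ZMod 2) (hf : IsForm K f) (J : Finset α)
    (g : α → XX n → ZMod 2) (hg : ∀ j ∈ J, ∃ i ∈ K, ∀ (x : XX n) a, g j (update x i a) = g j x) :
    |𝔼 x, sg (f x + ∑ j ∈ J, g j x)| ^ (2 ^ K.card) ≤ 𝔼 x, sg (f x) := by
  refine (cs_iter _ K).1.trans (le_of_eq ?_)
  have hnn := (cs_iter (fun x => f x + ∑ j ∈ J, g j x) K).2 hK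
  rw [abs_of_nonneg hnn]
  have : ∀ y x : XX n, ∑ ω ∈ K.powerset, (f (ω.piecewise y x) + ∑ j ∈ J, g j (ω.piecewise y x)) =
      f (x + y) := by
    intro y x
    rw [sum_add_distrib, cube_form hf, sum_comm]
    rw [sum_eq_zero, add_zero]
    intro j hj
    obtain ⟨i, hi, h⟩ := hg j hj
    exact cube_indep hi _ h x y
  simp_rw [this]
  have h2 : ∀ y : XX n, 𝔼 x, sg (f (x + y)) = 𝔼 x, sg (f x) := fun y =>
    Fintype.expect_equiv (Equiv.addRight y) _ _ (fun x => rfl)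
  simp_rw [h2]
  simp

/-- density of nonzeros -/
lemma form_density {K : Finset ι} {f : XX n → ZMod 2} (hf : IsForm K f) (hne : f ≠ 0) :
    (1 : ℝ) ≤ 2 ^ K.card * 𝔼 x, (if f x ≠ 0 then (1 : ℝ) else 0) := by
  obtain ⟨z, hz⟩ := Function.ne_iff.mp hne
  have h1 : ∀ x : XX n, (1 : ℝ) ≤ ∑ ω ∈ K.powerset,
      (if f (ω.piecewise (z + x) x) ≠ 0 then (1 : ℝ) else 0) := by
    intro x
    have h := cube_form hf x (z + x)
    have hzz : x + (z + x) = z := by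
      rw [add_comm z x, ← add_assoc, xx_add_self, zero_add]
    rw [hzz] at h
    have : ∃ ω ∈ K.powerset, f (ω.piecewise (z + x) x) ≠ 0 := by
      by_contra hcon
      push Not at hcon
      rw [sum_eq_zero hcon] at h
      exact hz h.symm
    obtain ⟨ω, hω, hne⟩ := this
    refine le_trans ?_ (single_le_sum (fun ω _ => ?_) hω)
    · rw [if_pos hne]
    · split_ifs <;> norm_num
  have h2 : ∀ ω ∈ K.powerset, 𝔼 x : XX n, (if f (ω.piecewise (z + x) x) ≠ 0 then (1 : ℝ) else 0) =
      𝔼 x, (if f x ≠ 0 then (1 : ℝ) else 0) := by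
    intro ω _
    refine Fintype.expect_bijective (fun x => ω.piecewise (z + x) x) ?_ _ _ (fun x => rfl)
    refine Involutive.bijective ?_
    intro x
    funext i
    by_cases hi : i ∈ ω
    · simp only [piecewise_eq_of_mem _ _ _ hi, Pi.add_apply]
      rw [← add_assoc, fun_add_self, zero_add]
    · simp [hi]
  calc (1 : ℝ) = 𝔼 x : XX n, (1 : ℝ) := by simp
    _ ≤ 𝔼 x : XX n, ∑ ω ∈ K.powerset, (if f (ω.piecewise (z + x) x) ≠ 0 then (1 : ℝ) else 0) :=
        expect_le_expect fun x _ => h1 x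
    _ = _ := by
      rw [expect_sum_comm, sum_congr rfl h2, sum_const, card_powerset]
      simp

end TP


namespace TP

open scoped BigOperators
open Function

set_option linter.unusedSectionVars false
set_option linter.unusedVariables false

variable {ι : Type} [Fintype ι] [DecidableEq ι] {n : ι → ℕ}

lemma ex_push {X Z : Type*} [AddCommGroup X] [AddCommGroup Z] [Fintype X] [Fintype Z]
    (π : Z → X) (σ : X → Z) (h : ∀ z x, π (z + σ x) = π z + x) (φ : X → ℝ) :
    𝔼 z, φ (π z) = 𝔼 x, φ x := by
  have h1 : ∀ x, 𝔼 z, φ (π z) = 𝔼 z, φ (π z + x) := fun x => by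
    rw [← Fintype.expect_equiv (Equiv.addRight (σ x)) (fun z => φ (π (z + σ x))) _ (fun z => rfl)]
    simp_rw [h]
  have h2 : 𝔼 z, φ (π z) = 𝔼 x : X, 𝔼 z, φ (π z + x) := by
    simp_rw [← h1]; simp
  rw [h2, expect_comm]
  have h3 : ∀ z, 𝔼 x, φ (π z + x) = 𝔼 x, φ x := fun z =>
    Fintype.expect_equiv (Equiv.addLeft (π z)) _ _ (fun z => rfl)
  simp_rw [h3]; simp

abbrev Fm (n : ι → ℕ) := Finset (Finset ι × (XX n → ZMod 2))

def Fam (E : Fm n) : Prop := ∀ p ∈ E, p.1.Nonempty ∧ IsForm p.1 p.2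

def Reg (E : Fm n) (ν : ℝ) : Prop :=
  Fam E ∧ ∀ I : Finset ι, ∀ S ⊆ E, S.Nonempty → (∀ p ∈ S, p.1 = I) →
    𝔼 x, sg (∑ p ∈ S, p.2 x) ≤ ν

def FactE {β : Type*} (E : Fm n) (f : XX n → β) : Prop :=
  ∀ x y, (∀ p ∈ E, p.2 x = p.2 y) → f x = f y

lemma abs_ex_sg_le {Y : Type*} [Fintype Y] (F : Y → ZMod 2) : |𝔼 y, sg (F y)| ≤ 1 := by
  refine (abs_expect_le _ _).trans ?_
  simp_rw [sg_abs]
  rcases isEmpty_or_nonempty Y <;> simp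

lemma colored {E : Fm n} {ν : ℝ} (hE : Reg E ν)
    (S : Finset ((Finset ι × (XX n → ZMod 2)) × (ι → Fin 3))) (hS : S.Nonempty)
    (hSE : ∀ s ∈ S, s.1 ∈ E ∧ ∀ i ∉ s.1.1, s.2 i = 0) :
    |𝔼 z : XX (fun k : ι × Fin 3 => n k.1), sg (∑ s ∈ S, s.1.2 (fun i => z (i, s.2 i)))|
      ^ (2 ^ Fintype.card ι) ≤ ν := by
  obtain ⟨s0, hs0, hmax⟩ := exists_max_image S (fun s => s.1.1.card) hS
  obtain ⟨hs0E, hχ0⟩ := hSE s0 hs0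
  obtain ⟨hne, hform0⟩ := hE.1 _ hs0E
  set K : Finset (ι × Fin 3) := s0.1.1.image (fun i => (i, s0.2 i)) with hK
  have hKne : K.Nonempty := hne.image _
  have hKc : K.card ≤ Fintype.card ι := card_image_le.trans (card_le_univ _)
  set P : (Finset ι × (XX n → ZMod 2)) × (ι → Fin 3) → Prop :=
    fun s => s.1.1 = s0.1.1 ∧ s.2 = s0.2 with hP
  have hsplit : ∀ z : XX (fun k : ι × Fin 3 => n k.1),
      ∑ s ∈ S, s.1.2 (fun i => z (i, s.2 i)) =
      ∑ s ∈ S.filter P, s.1.2 (fun i => z (i, s0.2 i)) +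
        ∑ s ∈ S.filter (fun s => ¬ P s), s.1.2 (fun i => z (i, s.2 i)) := by
    intro z
    rw [← sum_filter_add_sum_filter_not S P]
    congr 1
    apply sum_congr rfl
    intro s hs
    rw [(mem_filter.mp hs).2.2]
  have hf : IsForm K (∑ s ∈ S.filter P,
      fun z : XX (fun k : ι × Fin 3 => n k.1) => s.1.2 (fun i => z (i, s0.2 i))) := by
    apply IsForm.sum
    intro s hs
    obtain ⟨hsS, h1, h2⟩ := mem_filter.mp hs
    have hsf := (hE.1 _ (hSE s hsS).1).2
    rw [h1] at hsf
    refine ⟨fun x y h => hsf.dep _ _ fun i hi => h _ (mem_image_of_mem _ hi), ?_⟩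
    intro k hk x a b
    obtain ⟨i, hi, rfl⟩ := mem_image.mp hk
    have hu : ∀ a : Fin (n i) → ZMod 2,
        (fun j => (update x (i, s0.2 i) a : XX (fun k : ι × Fin 3 => n k.1)) (j, s0.2 j)) =
        update (fun j => x (j, s0.2 j)) i a := by
      intro a
      funext j
      by_cases hj : j = i
      · subst hj; simp
      · rw [update_of_ne hj, update_of_ne]
        intro h; exact hj (congrArg Prod.fst h)
    simp only [hu]
    exact hsf.add i hi _ a b
  have hg : ∀ s ∈ S.filter (fun s => ¬ P s), ∃ k ∈ K,
      ∀ (z : XX (fun k : ι × Fin 3 => n k.1)) a,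
        s.1.2 (fun i => (update z k a : XX (fun k : ι × Fin 3 => n k.1)) (i, s.2 i)) =
          s.1.2 (fun i => z (i, s.2 i)) := by
    intro s hs
    obtain ⟨hsS, hnP⟩ := mem_filter.mp hs
    obtain ⟨hsE', hχ⟩ := hSE s hsS
    have hsf := (hE.1 _ hsE').2
    have : ∃ i ∈ s0.1.1, i ∉ s.1.1 ∨ s.2 i ≠ s0.2 i := by
      by_contra hcon
      push Not at hcon
      apply hnP
      have hsub : s0.1.1 ⊆ s.1.1 := fun i hi => (hcon i hi).1
      have heq := eq_of_subset_of_card_le hsub (hmax s hsS)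
      refine ⟨heq.symm, ?_⟩
      funext i
      by_cases hi : i ∈ s0.1.1
      · exact (hcon i hi).2
      · rw [hχ0 i hi, hχ i (heq ▸ hi)]
    obtain ⟨i, hi, hor⟩ := this
    refine ⟨(i, s0.2 i), mem_image_of_mem _ hi, fun z a => hsf.dep _ _ fun j hj => ?_⟩
    rw [update_of_ne]
    intro h
    have h1 : j = i := congrArg Prod.fst h
    have h2 : s.2 j = s0.2 i := congrArg Prod.snd h
    subst h1
    rcases hor with h | h
    · exact h hj
    · exact h h2
  have hmain := cs_main K hKne _ hf _
    (fun (s : (Finset ι × (XX n → ZMod 2)) × (ι → Fin 3))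
      (z : XX (fun k : ι × Fin 3 => n k.1)) => s.1.2 (fun i => z (i, s.2 i))) hg
  have hrhs : 𝔼 z : XX (fun k : ι × Fin 3 => n k.1), sg ((∑ s ∈ S.filter P,
      fun z : XX (fun k : ι × Fin 3 => n k.1) => s.1.2 (fun i => z (i, s0.2 i))) z) ≤ ν := by
    simp only [Finset.sum_apply]
    rw [ex_push (fun z : XX (fun k : ι × Fin 3 => n k.1) => (fun i => z (i, s0.2 i) : XX n))
      (fun x k => x k.1) (fun z x => rfl) (fun x => sg (∑ s ∈ S.filter P, s.1.2 x))]
    have hi : ∀ x : XX n, ∑ s ∈ S.filter P, s.1.2 x = ∑ p ∈ (S.filter P).image Prod.fst, p.2 x := by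
      intro x
      rw [sum_image]
      intro s hs t ht hst
      have h1 := (mem_filter.mp hs).2.2
      have h2 := (mem_filter.mp ht).2.2
      exact Prod.ext hst (h1.trans h2.symm)
    simp_rw [hi]
    refine hE.2 s0.1.1 _ ?_ ?_ ?_
    · intro p hp
      obtain ⟨s, hs, rfl⟩ := mem_image.mp hp
      exact (hSE s (mem_filter.mp hs).1).1
    · exact ⟨s0.1, mem_image_of_mem _ (mem_filter.mpr ⟨hs0, rfl, rfl⟩)⟩
    · intro p hp
      obtain ⟨s, hs, rfl⟩ := mem_image.mp hp
      exact (mem_filter.mp hs).2.1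
  simp only [Finset.sum_apply] at hmain hrhs
  simp_rw [hsplit]
  refine le_trans ?_ (hmain.trans hrhs)
  exact pow_le_pow_of_le_one (abs_nonneg _) (abs_ex_sg_le _)
    (Nat.pow_le_pow_right (by norm_num) hKc)

lemma colored_le {E : Fm n} {ν κ : ℝ} (hE : Reg E ν) (hκ : 0 ≤ κ)
    (hν : ν ≤ κ ^ (2 ^ Fintype.card ι))
    (S : Finset ((Finset ι × (XX n → ZMod 2)) × (ι → Fin 3))) (hS : S.Nonempty)
    (hSE : ∀ s ∈ S, s.1 ∈ E ∧ ∀ i ∉ s.1.1, s.2 i = 0) :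
    |𝔼 w : XX n × XX n × XX n, sg (∑ s ∈ S, s.1.2 (fun i =>
      if s.2 i = 0 then w.1 i else if s.2 i = 1 then w.2.1 i else w.2.2 i))| ≤ κ := by
  have h := (colored hE S hS hSE).trans hν
  have h' := le_of_pow_le_pow_left₀ (by positivity) hκ h
  refine le_trans (le_of_eq ?_) h'
  congr 1
  rw [← ex_push (fun z : XX (fun k : ι × Fin 3 => n k.1) =>
    (((fun i => z (i, 0)), (fun i => z (i, 1)), (fun i => z (i, 2))) : XX n × XX n × XX n))
    (fun w k => if k.2 = 0 then w.1 k.1 else if k.2 = 1 then w.2.1 k.1 else w.2.2 k.1)]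
  · apply expect_congr rfl
    intro z _
    congr 1
    apply sum_congr rfl
    intro s _
    refine congrArg s.1.2 ?_
    funext i
    have : ∀ c : Fin 3, c = 0 ∨ c = 1 ∨ c = 2 := by decide
    generalize s.2 i = c
    rcases this c with h | h | h <;> subst h <;> simp
  · intro z w
    refine Prod.ext ?_ (Prod.ext ?_ ?_) <;> funext i <;> simp

lemma reg_char {E : Fm n} {ν κ : ℝ} (hE : Reg E ν) (hκ : 0 ≤ κ)
    (hν : ν ≤ κ ^ (2 ^ Fintype.card ι)) (S : Fm n) (hSE : S ⊆ E) (hS : S.Nonempty) :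
    |𝔼 x, sg (∑ p ∈ S, p.2 x)| ≤ κ := by
  have h := colored_le hE hκ hν (S.image fun p => (p, 0)) (hS.image _) (by
    intro s hs
    obtain ⟨p, hp, rfl⟩ := mem_image.mp hs
    exact ⟨hSE hp, fun _ _ => rfl⟩)
  refine le_trans (le_of_eq ?_) h
  congr 1
  rw [← ex_push (fun w : XX n × XX n × XX n => w.1) (fun x => (x, 0, 0)) (fun _ _ => rfl)]
  apply expect_congr rfl
  intro w _
  rw [sum_image (fun p _ q _ h => congrArg Prod.fst h)]
  simp

lemma atoms {α Y : Type*} [Fintype Y] [Nonempty Y] [DecidableEq α] (h : α → Y → ZMod 2)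
    (T : Finset α) (κ : ℝ) (hκ : 0 ≤ κ)
    (H : ∀ S ⊆ T, S.Nonempty → |𝔼 y, sg (∑ a ∈ S, h a y)| ≤ κ) (c : α → ZMod 2) :
    |𝔼 y, (if ∀ a ∈ T, h a y = c a then (1 : ℝ) else 0) - (1 / 2) ^ T.card| ≤ κ := by
  have h1 : ∀ y, (if ∀ a ∈ T, h a y = c a then (1 : ℝ) else 0) =
      (1 / 2) ^ T.card * ∑ S ∈ T.powerset, sg (∑ a ∈ S, c a) * sg (∑ a ∈ S, h a y) := by
    intro y
    have e1 : (if ∀ a ∈ T, h a y = c a then (1 : ℝ) else 0) =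
        ∏ a ∈ T, ((1 / 2) * (1 + sg (c a + h a y))) := by
      split_ifs with hh
      · symm
        apply prod_eq_one
        intro a ha
        rw [hh a ha, zmod2_add_self, sg_zero]; norm_num
      · push Not at hh
        obtain ⟨a, ha, hne⟩ := hh
        symm
        apply prod_eq_zero ha
        have : c a + h a y = 1 := by
          revert hne
          generalize c a = u; generalize h a y = v
          revert u v; decide
        rw [this, sg_one]; norm_num
    rw [e1, prod_mul_distrib, prod_const, prod_one_add]
    congr 1
    apply sum_congr rfl
    intro S _
    rw [← sg_sum, sum_add_distrib, sg_add]
  have h2 : 𝔼 y, (if ∀ a ∈ T, h a y = c a then (1 : ℝ) else 0) =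
      (1 / 2) ^ T.card * ∑ S ∈ T.powerset, sg (∑ a ∈ S, c a) * 𝔼 y, sg (∑ a ∈ S, h a y) := by
    simp_rw [h1]
    rw [← mul_expect, expect_sum_comm]
    simp_rw [← mul_expect]
  rw [h2, ← add_sum_erase _ _ (empty_mem_powerset T)]
  simp only [sum_empty, sg_zero, expect_const univ_nonempty]
  rw [show ∀ A B : ℝ, A * (1 * 1 + B) - A = A * B by intros; ring, abs_mul,
    abs_of_nonneg (by positivity)]
  have h3 : |∑ S ∈ T.powerset.erase ∅, sg (∑ a ∈ S, c a) * 𝔼 y, sg (∑ a ∈ S, h a y)| ≤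
      2 ^ T.card * κ := by
    refine (abs_sum_le_sum_abs _ _).trans ?_
    refine (sum_le_card_nsmul _ _ κ ?_).trans ?_
    · intro S hS
      rw [abs_mul, sg_abs, one_mul]
      exact H S (mem_powerset.mp (mem_of_mem_erase hS)) (nonempty_iff_ne_empty.mpr (ne_of_mem_erase hS))
    · rw [nsmul_eq_mul]
      refine mul_le_mul_of_nonneg_right ?_ hκ
      have := card_le_card (erase_subset (∅ : Finset α) T.powerset)
      rw [card_powerset] at this
      exact_mod_cast this
  calc _ ≤ (1 / 2 : ℝ) ^ T.card * (2 ^ T.card * κ) := by gcongr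
    _ = κ := by rw [← mul_assoc, ← mul_pow]; norm_num

end TP


namespace TP

open scoped BigOperators
open Function

set_option linter.unusedSectionVars false
set_option linter.unusedVariables false

variable {ι : Type} [Fintype ι] [DecidableEq ι] {n : ι → ℕ}

def IsPart (T : Fm n) (J : Finset ι) : Prop :=
  (∀ p ∈ T, ∀ q ∈ T, p ≠ q → Disjoint p.1 q.1) ∧ T.biUnion Prod.fst = J

def Poly (E : Fm n) (J : Finset ι) : Submodule (ZMod 2) (XX n → ZMod 2) :=
  Submodule.span (ZMod 2) {f | ∃ T ⊆ E, IsPart T J ∧ f = ∏ p ∈ T, p.2}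

lemma poly_gen {E T : Fm n} {J : Finset ι} (h : T ⊆ E) (hT : IsPart T J) :
    (∏ p ∈ T, p.2) ∈ Poly E J := Submodule.subset_span ⟨T, h, hT, rfl⟩

lemma poly_mono {E E' : Fm n} (h : E ⊆ E') (J : Finset ι) : Poly E J ≤ Poly E' J := by
  apply Submodule.span_mono
  rintro f ⟨T, hT, hp, rfl⟩
  exact ⟨T, hT.trans h, hp, rfl⟩

lemma poly_mem {E : Fm n} {p} (hp : p ∈ E) : p.2 ∈ Poly E p.1 := by
  have := poly_gen (J := p.1) (singleton_subset_iff.mpr hp) (by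
    refine ⟨?_, by simp⟩
    intro a ha b hb hab
    rw [mem_singleton] at ha hb
    exact absurd (ha.trans hb.symm) hab)
  simpa using this

lemma poly_one (E : Fm n) : (1 : XX n → ZMod 2) ∈ Poly E ∅ := by
  have := poly_gen (J := ∅) (empty_subset E) ⟨by simp, by simp⟩
  simpa using this

lemma poly_mul {E : Fm n} (hE : Fam E) {J J' : Finset ι} (hd : Disjoint J J')
    {f g : XX n → ZMod 2} (hf : f ∈ Poly E J) (hg : g ∈ Poly E J') : f * g ∈ Poly E (J ∪ J') := by
  induction hf using Submodule.span_induction with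
  | zero => simp
  | add a b _ _ ha hb => rw [add_mul]; exact Submodule.add_mem _ ha hb
  | smul c a _ ha => rw [smul_mul_assoc]; exact Submodule.smul_mem _ _ ha
  | mem a ha =>
    obtain ⟨T, hT, hp, rfl⟩ := ha
    induction hg using Submodule.span_induction with
    | zero => simp
    | add a b _ _ ha hb => rw [mul_add]; exact Submodule.add_mem _ ha hb
    | smul c a _ ha => rw [mul_smul_comm]; exact Submodule.smul_mem _ _ ha
    | mem b hb =>
      obtain ⟨T', hT', hp', rfl⟩ := hb
      have hs : ∀ p ∈ T, p.1 ⊆ J := fun p h => by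
        rw [← hp.2]; exact subset_biUnion_of_mem Prod.fst h
      have hs' : ∀ p ∈ T', p.1 ⊆ J' := fun p h => by
        rw [← hp'.2]; exact subset_biUnion_of_mem Prod.fst h
      have hdT : Disjoint T T' := by
        rw [Finset.disjoint_left]
        intro p h1 h2
        obtain ⟨i, hi⟩ := (hE p (hT h1)).1
        exact Finset.disjoint_left.mp hd (hs p h1 hi) (hs' p h2 hi)
      rw [← prod_union hdT]
      apply poly_gen (union_subset hT hT')
      refine ⟨?_, by rw [union_biUnion, hp.2, hp'.2]⟩
      intro p h1 q h2 hpq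
      rcases mem_union.mp h1 with h1 | h1 <;> rcases mem_union.mp h2 with h2 | h2
      · exact hp.1 p h1 q h2 hpq
      · exact hd.mono (hs p h1) (hs' q h2)
      · exact hd.symm.mono (hs' p h1) (hs q h2)
      · exact hp'.1 p h1 q h2 hpq

lemma poly_subst {E E' : Fm n} (hE' : Fam E') (h : ∀ p ∈ E, p.2 ∈ Poly E' p.1) (J : Finset ι) :
    Poly E J ≤ Poly E' J := by
  refine Submodule.span_le.mpr ?_
  rintro f ⟨T, hT, hp, rfl⟩
  obtain ⟨hp, rfl⟩ := hp
  show _ ∈ Poly E' _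
  induction T using Finset.induction_on with
  | empty => simpa using poly_one E'
  | insert p T hpT ih =>
    rw [prod_insert hpT, biUnion_insert]
    refine poly_mul hE' ?_ (h p (hT (mem_insert_self _ _)))
      (ih (fun q hq => hT (mem_insert_of_mem hq))
        (fun a ha b hb => hp a (mem_insert_of_mem ha) b (mem_insert_of_mem hb)))
    rw [disjoint_biUnion_right]
    intro q hq
    exact hp p (mem_insert_self _ _) q (mem_insert_of_mem hq) (by rintro rfl; exact hpT hq)

lemma isForm_one : IsForm (n := n) ∅ 1 := ⟨fun _ _ _ => rfl, by simp⟩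

lemma isForm_part {T : Fm n} (hT : Fam T) {J : Finset ι} (hp : IsPart T J) :
    IsForm J (∏ p ∈ T, p.2) := by
  obtain ⟨hp, rfl⟩ := hp
  induction T using Finset.induction_on with
  | empty => simpa using isForm_one
  | insert p T hpT ih =>
    rw [prod_insert hpT, biUnion_insert]
    refine IsForm.mul (hT p (mem_insert_self _ _)).2
      (ih (fun q hq => hT q (mem_insert_of_mem hq))
        (fun a ha b hb => hp a (mem_insert_of_mem ha) b (mem_insert_of_mem hb))) ?_
    rw [disjoint_biUnion_right]
    intro q hq
    exact hp p (mem_insert_self _ _) q (mem_insert_of_mem hq) (by rintro rfl; exact hpT hq)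

lemma poly_form {E : Fm n} (hE : Fam E) {J : Finset ι} {f : XX n → ZMod 2} (hf : f ∈ Poly E J) :
    IsForm J f := by
  induction hf using Submodule.span_induction with
  | zero => exact IsForm.zero J
  | add a b _ _ ha hb => exact ha.fadd hb
  | smul c a _ ha => exact ha.smul c
  | mem a ha =>
    obtain ⟨T, hT, hp, rfl⟩ := ha
    exact isForm_part (fun p hp => hE p (hT hp)) hp

lemma poly_fact {E : Fm n} {J : Finset ι} {f : XX n → ZMod 2} (hf : f ∈ Poly E J) :
    FactE E f := by
  induction hf using Submodule.span_induction with
  | zero => intro x y _; rfl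
  | add a b _ _ ha hb => intro x y h; simp [ha x y h, hb x y h]
  | smul c a _ ha => intro x y h; simp [ha x y h]
  | mem a ha =>
    obtain ⟨T, hT, hp, rfl⟩ := ha
    intro x y h
    simp only [Finset.prod_apply]
    exact prod_congr rfl fun p hp => h p (hT hp)

lemma Reg.mono {E : Fm n} {ν ν' : ℝ} (h : Reg E ν) (hν : ν ≤ ν') : Reg E ν' :=
  ⟨h.1, fun I S hS hne ht => (h.2 I S hS hne ht).trans hν⟩

def BR (ι : Type) [Fintype ι] [DecidableEq ι] (j : ℕ) : Prop :=
  ∀ c : ℝ, 0 < c → ∃ m : ℕ, ∀ n : ι → ℕ, ∀ I : Finset ι, I.card = j → ∀ f : XX n → ZMod 2,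
    IsForm I f → c ≤ 𝔼 x, sg (f x) →
    ∃ F : Fm n, F.card ≤ m ∧ Fam F ∧ (∀ p ∈ F, p.1 ⊂ I) ∧ f ∈ Poly F I

def SS (ι : Type) [Fintype ι] [DecidableEq ι] (j t : ℕ) : Prop :=
  ∀ Φ : ℕ → ℝ, (∀ k, 0 < Φ k) → Antitone Φ → ∀ N : ℕ, ∃ C : ℕ, ∃ ψ : ℝ, 0 < ψ ∧
    ∀ (n : ι → ℕ) (E Q : Fm n), E.card + Q.card ≤ N → Fam Q → (∀ q ∈ Q, q.1.card < j) →
      (Q.filter (fun q => q.1.card + 1 = j)).card ≤ t → Reg E ψ →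
      ∃ E' : Fm n, E ⊆ E' ∧ E'.card ≤ C ∧ Reg E' (Φ E'.card) ∧ (∀ q ∈ Q, q.2 ∈ Poly E' q.1) ∧
        ∀ p ∈ E', p ∈ E ∨ ∃ q ∈ Q, p.1 ⊆ q.1

lemma SS_zero (t : ℕ) : SS ι 0 t := by
  intro Φ hΦ hanti N
  refine ⟨N, Φ N, hΦ N, fun n E Q hN hQ hQj _ hE => ?_⟩
  refine ⟨E, Subset.refl _, by omega, hE.mono (hanti (by omega)), ?_, fun p hp => Or.inl hp⟩
  intro q hq
  exact absurd (hQj q hq) (by omega)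

lemma SS_succ_zero (j : ℕ) (h : ∀ t, SS ι j t) : SS ι (j + 1) 0 := by
  intro Φ hΦ hanti N
  obtain ⟨C, ψ, hψ, H⟩ := h N Φ hΦ hanti N
  refine ⟨C, ψ, hψ, fun n E Q hN hQ hQj hQt hE => ?_⟩
  refine H n E Q hN hQ ?_ ((card_filter_le _ _).trans (by omega)) hE
  intro q hq
  have h1 := hQj q hq
  have : q ∉ Q.filter (fun q => q.1.card + 1 = j + 1) := by
    rw [card_eq_zero.mp (Nat.le_zero.mp hQt)]; simp
  have h2 : ¬ (q.1.card + 1 = j + 1) := fun h => this (mem_filter.mpr ⟨hq, h⟩)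
  omega

lemma SS_succ_succ (j t : ℕ) (h : ∀ t, SS ι j t) (hBR : 0 < j → BR ι j) (ht : SS ι (j + 1) t) :
    SS ι (j + 1) (t + 1) := by
  intro Φ hΦ hanti N
  obtain ⟨C1, ψ1, hψ1, H1⟩ := h N (fun m => Φ (m + t + 1)) (fun k => hΦ _)
    (fun a b hab => hanti (by omega)) N
  have hm : ∃ m : ℕ, 0 < j → ∀ n : ι → ℕ, ∀ I : Finset ι, I.card = j → ∀ f : XX n → ZMod 2,
      IsForm I f → Φ (C1 + t + 1) ≤ 𝔼 x, sg (f x) →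
      ∃ F : Fm n, F.card ≤ m ∧ Fam F ∧ (∀ p ∈ F, p.1 ⊂ I) ∧ f ∈ Poly F I := by
    rcases j.eq_zero_or_pos with h0 | h0
    · exact ⟨0, fun h => by omega⟩
    · obtain ⟨m, hm⟩ := hBR h0 (Φ (C1 + t + 1)) (hΦ _)
      exact ⟨m, fun _ => hm⟩
  obtain ⟨m, hm⟩ := hm
  obtain ⟨C2, ψ2, hψ2, H2⟩ := ht Φ hΦ hanti (N + m)
  refine ⟨max (C1 + t + 1) C2, min ψ1 ψ2, lt_min hψ1 hψ2, fun n E Q hN hQ hQj hQt hE => ?_⟩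
  set Qt := Q.filter (fun q => q.1.card + 1 = j + 1) with hQtdef
  set Ql := Q.filter (fun q => ¬ (q.1.card + 1 = j + 1)) with hQldef
  have hQlc : Ql.card ≤ Q.card := card_filter_le _ _
  have hQlj : ∀ q ∈ Ql, q.1.card < j := by
    intro q hq
    obtain ⟨h1, h2⟩ := mem_filter.mp hq
    have := hQj q h1
    omega
  obtain ⟨E1, hEE1, hE1c, hE1r, hE1p, hE1t⟩ := H1 n E Ql (by omega)
    (fun q hq => hQ q (mem_filter.mp hq).1) hQlj
    ((card_filter_le _ _).trans (by omega)) (hE.mono (min_le_left _ _))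
  have hcardU : (E1 ∪ Qt).card ≤ E1.card + t + 1 := (card_union_le _ _).trans (by omega)
  have hFamU : Fam (E1 ∪ Qt) := by
    intro p hp
    rcases mem_union.mp hp with hp | hp
    · exact hE1r.1 p hp
    · exact hQ p (mem_filter.mp hp).1
  by_cases hreg : Reg (E1 ∪ Qt) (Φ (E1 ∪ Qt).card)
  · refine ⟨E1 ∪ Qt, hEE1.trans subset_union_left, ?_, hreg, ?_, ?_⟩
    · exact le_max_of_le_left (by omega)
    · intro q hq
      by_cases hqt : q.1.card + 1 = j + 1
      · exact poly_mem (mem_union_right _ (mem_filter.mpr ⟨hq, hqt⟩))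
      · exact poly_mono subset_union_left _ (hE1p q (mem_filter.mpr ⟨hq, hqt⟩))
    · intro p hp
      rcases mem_union.mp hp with hp | hp
      · rcases hE1t p hp with h | ⟨q, hq, h⟩
        · exact Or.inl h
        · exact Or.inr ⟨q, (mem_filter.mp hq).1, h⟩
      · exact Or.inr ⟨p, (mem_filter.mp hp).1, Subset.refl _⟩
  · have hex : ∃ I : Finset ι, ∃ S ⊆ E1 ∪ Qt, S.Nonempty ∧ (∀ p ∈ S, p.1 = I) ∧
        Φ (E1 ∪ Qt).card < 𝔼 x, sg (∑ p ∈ S, p.2 x) := by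
      by_contra hcon
      push Not at hcon
      exact hreg ⟨hFamU, fun I S h1 h2 h3 => hcon I S h1 h2 h3⟩
    obtain ⟨I, S, hSU, hSne, hSI, hbias⟩ := hex
    have hnot : ¬ S ⊆ E1 := by
      intro hS
      have h1 := hE1r.2 I S hS hSne hSI
      have h2 : Φ (E1.card + t + 1) ≤ Φ (E1 ∪ Qt).card := hanti hcardU
      linarith
    obtain ⟨q, hqS, hqE1⟩ := not_subset.mp hnot
    have hqt : q ∈ Qt := (mem_union.mp (hSU hqS)).resolve_left hqE1
    obtain ⟨hqQ, hqj⟩ := mem_filter.mp hqt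
    have hqI : q.1 = I := hSI q hqS
    have hIj : I.card = j := by rw [← hqI]; omega
    have hj0 : 0 < j := by
      rw [← hIj, ← hqI]; exact card_pos.mpr (hQ q hqQ).1
    have hSform : IsForm I (∑ p ∈ S, p.2) := by
      apply IsForm.sum
      intro p hp
      have := (hFamU p (hSU hp)).2
      rwa [hSI p hp] at this
    obtain ⟨F, hFm, hFfam, hFI, hFp⟩ := hm hj0 n I hIj _ hSform (by
      simp only [Finset.sum_apply]
      exact (hanti (by omega)).trans hbias.le)
    have hQ'c : (Q.erase q ∪ F).card ≤ Q.card + m :=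
      (card_union_le _ _).trans (add_le_add (card_le_card (erase_subset _ _)) hFm)
    obtain ⟨E2, hEE2, hE2c, hE2r, hE2p, hE2t⟩ := H2 n E (Q.erase q ∪ F) (by omega) (by
        intro p hp
        rcases mem_union.mp hp with hp | hp
        · exact hQ p (mem_of_mem_erase hp)
        · exact hFfam p hp) (by
        intro p hp
        rcases mem_union.mp hp with hp | hp
        · exact hQj p (mem_of_mem_erase hp)
        · have := card_lt_card (hFI p hp); omega) (by
        have hsub : (Q.erase q ∪ F).filter (fun q => q.1.card + 1 = j + 1) ⊆ Qt.erase q := by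
          intro p hp
          obtain ⟨hp, hpj⟩ := mem_filter.mp hp
          rcases mem_union.mp hp with hp | hp
          · exact mem_erase.mpr ⟨ne_of_mem_erase hp, mem_filter.mpr ⟨mem_of_mem_erase hp, hpj⟩⟩
          · have := card_lt_card (hFI p hp); omega
        have h1 := card_le_card hsub
        rw [card_erase_of_mem hqt] at h1
        omega) (hE.mono (min_le_right _ _))
    refine ⟨E2, hEE2, le_max_of_le_right hE2c, hE2r, ?_, ?_⟩
    · intro q' hq'
      by_cases hqq : q' = q
      · subst hqq
        have h1 : (∑ p ∈ S, p.2) ∈ Poly E2 I :=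
          poly_subst hE2r.1 (fun p hp => hE2p p (mem_union_right _ hp)) I hFp
        have h2 : (∑ p ∈ S.erase q', p.2) ∈ Poly E2 I := by
          apply Submodule.sum_mem
          intro p hp
          obtain ⟨hpq, hpS⟩ := mem_erase.mp hp
          have hpI := hSI p hpS
          rw [← hpI]
          rcases mem_union.mp (hSU hpS) with hp1 | hp1
          · rcases hE1t p hp1 with hpE | ⟨q2, hq2, hsub⟩
            · exact poly_mem (hEE2 hpE)
            · exfalso
              have h3 := card_le_card hsub
              have h4 := hQlj q2 hq2
              rw [hpI] at h3
              omega
          · exact hE2p p (mem_union_left _ (mem_erase.mpr ⟨hpq, (mem_filter.mp hp1).1⟩))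
        have h3 : q'.2 = (∑ p ∈ S, p.2) - ∑ p ∈ S.erase q', p.2 := by
          rw [← add_sum_erase S _ hqS]; simp
        rw [h3, hqI]
        exact Submodule.sub_mem _ h1 h2
      · exact hE2p q' (mem_union_left _ (mem_erase.mpr ⟨hqq, hq'⟩))
    · intro p hp
      rcases hE2t p hp with h | ⟨q', hq', hs⟩
      · exact Or.inl h
      · right
        rcases mem_union.mp hq' with hq' | hq'
        · exact ⟨q', mem_of_mem_erase hq', hs⟩
        · exact ⟨q, hqQ, by rw [hqI]; exact hs.trans (hFI q' hq').1⟩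

lemma SS_all (j : ℕ) (hBR : ∀ i, 0 < i → i < j → BR ι i) : ∀ t, SS ι j t := by
  induction j with
  | zero => exact SS_zero
  | succ j ih =>
    have h := ih fun i h0 hi => hBR i h0 (by omega)
    intro t
    induction t with
    | zero => exact SS_succ_zero j h
    | succ t iht => exact SS_succ_succ j t h (fun h0 => hBR j h0 (by omega)) iht

end TP


namespace TP

open scoped BigOperators
open Function

set_option linter.unusedSectionVars false
set_option linter.unusedVariables false

variable {ι : Type} [Fintype ι] [DecidableEq ι] {n : ι → ℕ}

open Classical in
/-- indicator -/
noncomputable def ind (p : Prop) : ℝ := if p then 1 else 0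

lemma ind_pos {p : Prop} (h : p) : ind p = 1 := by simp [ind, h]
lemma ind_neg {p : Prop} (h : ¬ p) : ind p = 0 := by simp [ind, h]
lemma ind_nonneg (p : Prop) : 0 ≤ ind p := by
  by_cases h : p
  · rw [ind_pos h]; norm_num
  · rw [ind_neg h]
lemma ind_le_one (p : Prop) : ind p ≤ 1 := by
  by_cases h : p
  · rw [ind_pos h]
  · rw [ind_neg h]; norm_num
lemma ind_ite (p : Prop) [Decidable p] : ind p = if p then 1 else 0 := by
  by_cases h : p
  · rw [ind_pos h, if_pos h]
  · rw [ind_neg h, if_neg h]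
lemma ind_mono {p q : Prop} (h : p → q) : ind p ≤ ind q := by
  by_cases hp : p
  · rw [ind_pos hp, ind_pos (h hp)]
  · rw [ind_neg hp]; exact ind_nonneg q
lemma ind_or (p q : Prop) : ind (p ∨ q) ≤ ind p + ind q := by
  have h1 := ind_nonneg p
  have h2 := ind_nonneg q
  by_cases hp : p
  · rw [ind_pos hp, ind_pos (Or.inl hp)]; linarith
  · by_cases hq : q
    · rw [ind_pos hq, ind_pos (Or.inr hq)]; linarith
    · rw [ind_neg (by tauto)]; linarith

lemma exists_le_ex {Y : Type*} [Fintype Y] [Nonempty Y] (f : Y → ℝ) {b : ℝ} (h : 𝔼 y, f y ≤ b) :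
    ∃ y, f y ≤ b := by
  obtain ⟨y, _, hy⟩ := exists_le_of_expect_le univ_nonempty h
  exact ⟨y, hy⟩

lemma bv (g : XX n → ℝ) (hg : ∀ x, |g x| ≤ 1) (L : ℕ) :
    ∃ a : ℕ → XX n, 𝔼 x, (∑ l ∈ range L, (g (x + a l) - 𝔼 x, g x)) ^ 2 ≤ (L : ℝ) := by
  induction L with
  | zero => exact ⟨0, by simp⟩
  | succ L ih =>
    obtain ⟨a, ha⟩ := ih
    set b := 𝔼 x, g x with hb
    set S : XX n → ℝ := fun x => ∑ l ∈ range L, (g (x + a l) - b) with hS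
    have hshift : ∀ (φ : XX n → ℝ) x, 𝔼 t, φ (x + t) = 𝔼 t, φ t := fun φ x =>
      Fintype.expect_equiv (Equiv.addLeft x) _ _ (fun _ => rfl)
    have havg : 𝔼 t : XX n, 𝔼 x : XX n, (S x + (g (x + t) - b)) ^ 2 ≤ L + 1 := by
      rw [expect_comm]
      have h1 : ∀ x, 𝔼 t, (S x + (g (x + t) - b)) ^ 2 ≤ S x ^ 2 + 1 := by
        intro x
        rw [hshift (fun t => (S x + (g t - b)) ^ 2)]
        have h2 : ∀ t, (S x + (g t - b)) ^ 2 = (S x - b) ^ 2 + (2 * (S x - b)) * g t + g t ^ 2 := by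
          intro t; ring
        simp_rw [h2]
        rw [expect_add_distrib, expect_add_distrib, ← mul_expect, ← hb,
          expect_const univ_nonempty]
        have h3 : 𝔼 t, g t ^ 2 ≤ 1 := by
          apply expect_le univ_nonempty
          intro t _
          rw [← sq_abs]
          exact pow_le_one₀ (abs_nonneg _) (hg t)
        nlinarith [sq_nonneg b]
      calc _ ≤ 𝔼 x, (S x ^ 2 + 1) := expect_le_expect fun x _ => h1 x
        _ = 𝔼 x, S x ^ 2 + 1 := by rw [expect_add_distrib, expect_const univ_nonempty]
        _ ≤ _ := by linarith
    obtain ⟨t, ht⟩ := exists_le_ex _ havg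
    refine ⟨fun l => if l = L then t else a l, ?_⟩
    push_cast
    refine le_trans (le_of_eq ?_) ht
    apply expect_congr rfl
    intro x _
    rw [sum_range_succ]
    congr 2
    · apply sum_congr rfl
      intro l hl
      rw [if_neg (by have := mem_range.mp hl; omega)]
    · simp

lemma predictor (c σ : ℝ) (hc : 0 < c) (hσ : 0 < σ) : ∃ L : ℕ, ∀ (n : ι → ℕ) (r : XX n → ZMod 2),
    c ≤ 𝔼 x, sg (r x) → ∃ a : ℕ → XX n, ∃ P : XX n → ZMod 2,
      (∀ x y, (∀ l < L, r (x + a l) + r x = r (y + a l) + r y) → P x = P y) ∧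
      𝔼 x, ind (r x ≠ P x) ≤ σ := by
  obtain ⟨L, hL⟩ := exists_nat_gt (1 / (σ * c ^ 2))
  refine ⟨L, fun n r hr => ?_⟩
  have hL0 : (0 : ℝ) < L := lt_trans (by positivity) hL
  obtain ⟨a, ha⟩ := bv (fun x => sg (r x)) (fun x => (sg_abs _).le) L
  refine ⟨a, fun x => if 0 ≤ ∑ l ∈ range L, sg (r (x + a l) + r x) then 0 else 1, ?_, ?_⟩
  · intro x y h
    have : ∑ l ∈ range L, sg (r (x + a l) + r x) = ∑ l ∈ range L, sg (r (y + a l) + r y) :=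
      sum_congr rfl fun l hl => by rw [h l (mem_range.mp hl)]
    simp only [this]
  · set b := 𝔼 x, sg (r x) with hb
    have hpt : ∀ x, ind (r x ≠ if 0 ≤ ∑ l ∈ range L, sg (r (x + a l) + r x) then 0 else 1) *
        (L * c) ^ 2 ≤ (∑ l ∈ range L, (sg (r (x + a l)) - b)) ^ 2 := by
      intro x
      by_cases hx : r x ≠ if 0 ≤ ∑ l ∈ range L, sg (r (x + a l) + r x) then 0 else 1
      · rw [ind_pos hx, one_mul]
        have hs : ∑ l ∈ range L, sg (r (x + a l)) ≤ 0 := by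
          simp_rw [sg_add] at hx
          rw [← sum_mul] at hx
          rcases zmod2_cases (r x) with h | h
          · rw [h] at hx
            simp only [sg_zero, mul_one] at hx
            by_contra hcon
            push Not at hcon
            rw [if_pos hcon.le] at hx
            exact hx rfl
          · rw [h] at hx
            simp only [sg_one] at hx
            by_contra hcon
            push Not at hcon
            rw [if_neg (by linarith)] at hx
            exact hx rfl
        rw [sum_sub_distrib, sum_const, card_range, nsmul_eq_mul]
        have h1 : (L : ℝ) * c ≤ L * b := mul_le_mul_of_nonneg_left hr hL0.le
        have h2 : 0 ≤ (L : ℝ) * c := by positivity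
        nlinarith
      · rw [ind_neg hx, zero_mul]; positivity
    have h1 : (𝔼 x, ind (r x ≠ if 0 ≤ ∑ l ∈ range L, sg (r (x + a l) + r x) then 0 else 1)) *
        (L * c) ^ 2 ≤ L := by
      rw [expect_mul]
      exact (expect_le_expect fun x _ => hpt x).trans ha
    rw [div_lt_iff₀ (by positivity)] at hL
    by_contra hcon
    push Not at hcon
    have h2 : σ * (L * c) ^ 2 <
      (𝔼 x, ind (r x ≠ if 0 ≤ ∑ l ∈ range L, sg (r (x + a l) + r x) then 0 else 1)) *
        (L * c) ^ 2 := mul_lt_mul_of_pos_right hcon (by positivity)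
    nlinarith

/-- pattern version of atoms -/
lemma atoms' {α Y : Type*} [Fintype Y] [Nonempty Y] [DecidableEq α] (h : α → Y → ZMod 2)
    (T : Finset α) (κ : ℝ) (hκ : 0 ≤ κ)
    (H : ∀ S ⊆ T, S.Nonempty → |𝔼 y, sg (∑ a ∈ S, h a y)| ≤ κ) (A : Finset α) (hA : A ⊆ T) :
    |𝔼 y, ind (T.filter (fun a => h a y = 1) = A) - (1 / 2) ^ T.card| ≤ κ := by
  have := atoms h T κ hκ H (fun a => if a ∈ A then 1 else 0)
  convert this using 5 with y
  rw [ind_ite]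
  congr 1
  apply propext
  constructor
  · rintro rfl a ha
    by_cases h1 : h a y = 1
    · rw [if_pos (mem_filter.mpr ⟨ha, h1⟩), h1]
    · have h2 : a ∉ T.filter (fun a => h a y = 1) := fun hh => h1 (mem_filter.mp hh).2
      rw [if_neg h2]
      exact (zmod2_cases _).resolve_right h1
  · intro hh
    ext a
    rw [mem_filter]
    constructor
    · rintro ⟨ha, h1⟩
      by_contra hcon
      have := hh a ha
      rw [if_neg hcon, h1] at this
      exact absurd this (by decide)
    · intro ha
      exact ⟨hA ha, by rw [hh a (hA ha), if_pos ha]⟩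

lemma pigeon {α Y : Type*} [Fintype Y] [Nonempty Y] [DecidableEq α] (h h' : α → Y → ZMod 2)
    (T : Finset α) (κ : ℝ) (hκ : 0 ≤ κ) (hκ1 : κ ≤ 1 / 2 * (1 / 2) ^ T.card)
    (H : ∀ S ⊆ T, S.Nonempty → |𝔼 y, sg (∑ a ∈ S, h a y)| ≤ κ)
    (H' : ∀ S ⊆ T, S.Nonempty → |𝔼 y, sg (∑ a ∈ S, h' a y)| ≤ κ)
    (B B' : Y → Prop) (hB : 𝔼 y, ind (B y) ≤ 1 / 8) (hB' : 𝔼 y, ind (B' y) ≤ 1 / 8) :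
    ∃ y y', (∀ a ∈ T, h a y = h' a y') ∧ ¬ B y ∧ ¬ B' y' := by
  by_contra hcon
  push Not at hcon
  have hsum : ∀ (g : α → Y → ZMod 2) (C : Y → Prop), ∑ A ∈ T.powerset,
      𝔼 y, ind (T.filter (fun a => g a y = 1) = A ∧ C y) ≤ 𝔼 y, ind (C y) := by
    intro g C
    rw [← expect_sum_comm]
    apply expect_le_expect
    intro y _
    by_cases hC : C y
    · rw [ind_pos hC]
      have : ∀ A ∈ T.powerset, ind (T.filter (fun a => g a y = 1) = A ∧ C y) =
          if T.filter (fun a => g a y = 1) = A then 1 else 0 := by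
        intro A _
        rw [← ind_ite]; congr 1; simp [hC]
      rw [sum_congr rfl this, sum_ite_eq]
      split_ifs <;> norm_num
    · rw [ind_neg hC]
      apply le_of_eq
      apply sum_eq_zero
      intro A _
      rw [ind_neg (by tauto)]
  have hA : ∀ A ∈ T.powerset, 1 / 2 * (1 / 2 : ℝ) ^ T.card ≤
      𝔼 y, ind (T.filter (fun a => h a y = 1) = A ∧ B y) +
      𝔼 y, ind (T.filter (fun a => h' a y = 1) = A ∧ B' y) := by
    intro A hA
    have h1 := (abs_le.mp (atoms' h T κ hκ H A (mem_powerset.mp hA))).1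
    have h2 := (abs_le.mp (atoms' h' T κ hκ H' A (mem_powerset.mp hA))).1
    have n1 : 0 ≤ 𝔼 y, ind (T.filter (fun a => h a y = 1) = A ∧ B y) :=
      expect_nonneg fun _ _ => ind_nonneg _
    have n2 : 0 ≤ 𝔼 y, ind (T.filter (fun a => h' a y = 1) = A ∧ B' y) :=
      expect_nonneg fun _ _ => ind_nonneg _
    by_cases hall : ∀ y, T.filter (fun a => h a y = 1) = A → B y
    · have : 𝔼 y, ind (T.filter (fun a => h a y = 1) = A) ≤
          𝔼 y, ind (T.filter (fun a => h a y = 1) = A ∧ B y) :=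
        expect_le_expect fun y _ => ind_mono fun hy => ⟨hy, hall y hy⟩
      linarith
    · push Not at hall
      obtain ⟨y, hy, hyB⟩ := hall
      have : 𝔼 y, ind (T.filter (fun a => h' a y = 1) = A) ≤
          𝔼 y, ind (T.filter (fun a => h' a y = 1) = A ∧ B' y) := by
        refine expect_le_expect fun y' _ => ind_mono fun hy' => ⟨hy', hcon y y' ?_ hyB⟩
        intro a ha
        have e : a ∈ T.filter (fun a => h a y = 1) ↔ a ∈ T.filter (fun a => h' a y' = 1) := by
          rw [hy, hy']
        simp only [mem_filter, ha, true_and] at e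
        rcases zmod2_cases (h a y) with h3 | h3 <;> rcases zmod2_cases (h' a y') with h4 | h4 <;>
          simp_all
      linarith
  have h3 := sum_le_sum hA
  rw [sum_add_distrib, sum_const, card_powerset, nsmul_eq_mul] at h3
  have h4 := hsum h B
  have h5 := hsum h' B'
  have h6 : ((2 ^ T.card : ℕ) : ℝ) * (1 / 2 * (1 / 2 : ℝ) ^ T.card) = 1 / 2 := by
    push_cast
    rw [mul_left_comm, ← mul_pow]; norm_num
  linarith

end TP


namespace TP

open scoped BigOperators
open Function

set_option linter.unusedSectionVars false
set_option linter.unusedVariables false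

variable {ι : Type} [Fintype ι] [DecidableEq ι] {n : ι → ℕ}

def hh (s : (Finset ι × (XX n → ZMod 2)) × Finset ι) (y a : XX n) : ZMod 2 :=
  s.1.2 (s.2.piecewise y a)

def idx (E : Fm n) : Finset ((Finset ι × (XX n → ZMod 2)) × Finset ι) :=
  (E ×ˢ (univ : Finset (Finset ι))).filter (fun s => s.2 ⊂ s.1.1)

def Good (E : Fm n) (κ : ℝ) (y : XX n) : Prop :=
  ∀ S ⊆ idx E, S.Nonempty → |𝔼 a, sg (∑ s ∈ S, hh s y a)| ≤ κ

lemma idx_card (E : Fm n) : (idx E).card ≤ E.card * 2 ^ Fintype.card ι := by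
  refine (card_filter_le _ _).trans ?_
  rw [card_product, card_univ, Fintype.card_finset]

def chi (c : Fin 3) (s : (Finset ι × (XX n → ZMod 2)) × Finset ι) : ι → Fin 3 :=
  fun i => if i ∈ s.1.1 ∧ i ∉ s.2 then c else 0

lemma chi_inj {c : Fin 3} (hc : c ≠ 0) {s t : (Finset ι × (XX n → ZMod 2)) × Finset ι}
    (hs : s.2 ⊆ s.1.1) (ht : t.2 ⊆ t.1.1) (h1 : s.1 = t.1) (h2 : chi c s = chi c t) : s = t := by
  refine Prod.ext h1 ?_
  ext i
  have := congrFun h2 i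
  simp only [chi, ← h1] at this
  rw [← h1] at ht
  by_cases hi : i ∈ s.1.1
  · by_cases ha : i ∈ s.2 <;> by_cases hb : i ∈ t.2 <;> simp_all
  · exact ⟨fun h => absurd (hs h) hi, fun h => absurd (ht h) hi⟩

lemma claim1 {E : Fm n} {ν κ : ℝ} (hE : Reg E ν) (hκ : 0 ≤ κ)
    (hν : ν ≤ κ ^ (2 ^ Fintype.card ι))
    (S : Finset ((Finset ι × (XX n → ZMod 2)) × Finset ι)) (hS : S ⊆ idx E) (hne : S.Nonempty) :
    𝔼 y, (𝔼 a, sg (∑ s ∈ S, hh s y a)) ^ 2 ≤ κ := by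
  have hmem : ∀ s ∈ S, s.1 ∈ E ∧ s.2 ⊂ s.1.1 := by
    intro s hs
    have := mem_filter.mp (hS hs)
    exact ⟨(mem_product.mp this.1).1, this.2⟩
  have h1 : 𝔼 y : XX n, (𝔼 a, sg (∑ s ∈ S, hh s y a)) ^ 2 =
      𝔼 w : XX n × XX n × XX n, sg (∑ s ∈ S, hh s w.1 w.2.1 + ∑ s ∈ S, hh s w.1 w.2.2) := by
    rw [← univ_product_univ, expect_product]
    apply expect_congr rfl
    intro y _
    rw [← univ_product_univ, expect_product, sq, expect_mul]
    apply expect_congr rfl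
    intro a _
    rw [mul_expect]
    apply expect_congr rfl
    intro a' _
    rw [sg_add]
  rw [h1]
  set S1 := S.image (fun s => (s.1, chi 1 s)) with hS1
  set S2 := S.image (fun s => (s.1, chi 2 s)) with hS2
  have hdis : Disjoint S1 S2 := by
    rw [Finset.disjoint_left]
    intro p hp1 hp2
    obtain ⟨s, hs, rfl⟩ := mem_image.mp hp1
    obtain ⟨t, ht, hst⟩ := mem_image.mp hp2
    obtain ⟨i, hi, hi2⟩ := exists_of_ssubset (hmem s hs).2
    have h3 := congrFun (congrArg Prod.snd hst) i
    simp only [chi, hi, hi2, not_false_eq_true, and_self, if_true] at h3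
    split_ifs at h3
    · exact absurd h3 (by decide)
    · exact absurd h3 (by decide)
  have hcol := colored_le hE hκ hν (S1 ∪ S2) (hne.image _ |>.mono subset_union_left) (by
    intro p hp
    rcases mem_union.mp hp with hp | hp <;> obtain ⟨s, hs, rfl⟩ := mem_image.mp hp <;>
      refine ⟨(hmem s hs).1, fun i hi => ?_⟩ <;> simp only at hi <;> simp [chi, hi])
  refine le_trans (le_of_eq ?_) ((le_abs_self _).trans hcol)
  apply expect_congr rfl
  intro w _
  congr 1
  rw [sum_union hdis, hS1, hS2, sum_image, sum_image]
  · congr 1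
    · apply sum_congr rfl
      intro s hs
      apply (hE.1 _ (hmem s hs).1).2.dep
      intro i hi
      by_cases h : i ∈ s.2 <;> simp [chi, hi, h]
    · apply sum_congr rfl
      intro s hs
      apply (hE.1 _ (hmem s hs).1).2.dep
      intro i hi
      by_cases h : i ∈ s.2 <;> simp [chi, hi, h]
  · intro s hs t ht hst
    exact chi_inj (by decide) (hmem s hs).2.1 (hmem t ht).2.1 (Prod.ext_iff.mp hst).1
      (Prod.ext_iff.mp hst).2
  · intro s hs t ht hst
    exact chi_inj (by decide) (hmem s hs).2.1 (hmem t ht).2.1 (Prod.ext_iff.mp hst).1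
      (Prod.ext_iff.mp hst).2

lemma claim2 {E : Fm n} {ν κ κ1 : ℝ} (hE : Reg E ν) (hκ : 0 ≤ κ) (hκ1 : 0 < κ1)
    (hν : ν ≤ κ ^ (2 ^ Fintype.card ι)) :
    κ1 ^ 2 * 𝔼 y, ind (¬ Good E κ1 y) ≤ 2 ^ (idx E).card * κ := by
  classical
  have hpt : ∀ y, κ1 ^ 2 * ind (¬ Good E κ1 y) ≤
      ∑ S ∈ (idx E).powerset.erase ∅, (𝔼 a, sg (∑ s ∈ S, hh s y a)) ^ 2 := by
    intro y
    by_cases hy : Good E κ1 y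
    · rw [ind_neg (by simpa using hy), mul_zero]
      exact sum_nonneg fun _ _ => sq_nonneg _
    · rw [ind_pos hy, mul_one]
      unfold Good at hy
      push Not at hy
      obtain ⟨S, hS, hne, hlt⟩ := hy
      refine le_trans ?_ (single_le_sum (f := fun S => (𝔼 a, sg (∑ s ∈ S, hh s y a)) ^ 2)
        (fun _ _ => sq_nonneg _) (mem_erase.mpr ⟨hne.ne_empty, mem_powerset.mpr hS⟩))
      show κ1 ^ 2 ≤ (𝔼 a, sg (∑ s ∈ S, hh s y a)) ^ 2
      rw [← sq_abs (𝔼 a, sg (∑ s ∈ S, hh s y a))]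
      exact pow_le_pow_left₀ hκ1.le hlt.le 2
  rw [mul_expect]
  refine (expect_le_expect fun y _ => hpt y).trans ?_
  rw [expect_sum_comm]
  refine (sum_le_card_nsmul _ _ κ ?_).trans ?_
  · intro S hS
    exact claim1 hE hκ hν S (mem_powerset.mp (mem_of_mem_erase hS))
      (nonempty_iff_ne_empty.mpr (ne_of_mem_erase hS))
  · rw [nsmul_eq_mul]
    refine mul_le_mul_of_nonneg_right ?_ hκ
    have := card_le_card (erase_subset (∅ : Finset _) (idx E).powerset)
    rw [card_powerset] at this
    exact_mod_cast this

lemma pw_invol (ω : Finset ι) (y : XX n) : Involutive (fun x : XX n => ω.piecewise (y + x) x) := by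
  intro x
  funext i
  by_cases hi : i ∈ ω
  · simp only [piecewise_eq_of_mem _ _ _ hi, Pi.add_apply]
    rw [← add_assoc, fun_add_self, zero_add]
  · simp [hi]

lemma boost_err {I : Finset ι} {r : XX n → ZMod 2} (hr : IsForm I r) (P : XX n → ZMod 2)
    (hP : 𝔼 x, ind (r x ≠ P x) ≤ (1 / 2) ^ Fintype.card ι * (1 / 8)) (y : XX n) :
    𝔼 a, ind (∑ ω ∈ I.powerset, P (ω.piecewise (y + a) a) ≠ r y) ≤ 1 / 8 := by
  have hpt : ∀ a : XX n, ind (∑ ω ∈ I.powerset, P (ω.piecewise (y + a) a) ≠ r y) ≤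
      ∑ ω ∈ I.powerset, ind (r (ω.piecewise (y + a) a) ≠ P (ω.piecewise (y + a) a)) := by
    intro a
    by_cases h : ∑ ω ∈ I.powerset, P (ω.piecewise (y + a) a) ≠ r y
    · have h2 := cube_form hr a (y + a)
      have hzz : a + (y + a) = y := by
        rw [add_comm y a, ← add_assoc, xx_add_self, zero_add]
      rw [hzz] at h2
      have : ∃ ω ∈ I.powerset, r (ω.piecewise (y + a) a) ≠ P (ω.piecewise (y + a) a) := by
        by_contra hcon
        push Not at hcon
        apply h
        rw [← h2]
        exact sum_congr rfl fun ω hω => (hcon ω hω).symm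
      obtain ⟨ω, hω, hne⟩ := this
      rw [ind_pos h, ← ind_pos hne]
      exact single_le_sum (f := fun ω : Finset ι =>
        ind (r (ω.piecewise (y + a) a) ≠ P (ω.piecewise (y + a) a))) (fun _ _ => ind_nonneg _) hω
    · rw [ind_neg h]
      exact sum_nonneg fun _ _ => ind_nonneg _
  refine (expect_le_expect fun a _ => hpt a).trans ?_
  rw [expect_sum_comm]
  have h2 : ∀ ω ∈ I.powerset, 𝔼 a : XX n,
      ind (r (ω.piecewise (y + a) a) ≠ P (ω.piecewise (y + a) a)) = 𝔼 x, ind (r x ≠ P x) := by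
    intro ω _
    exact Fintype.expect_bijective (fun x => ω.piecewise (y + x) x) (pw_invol ω y).bijective
      _ _ (fun x => rfl)
  rw [sum_congr rfl h2, sum_const, card_powerset, nsmul_eq_mul]
  have hI : ((2 ^ I.card : ℕ) : ℝ) ≤ 2 ^ Fintype.card ι := by
    push_cast
    exact pow_le_pow_right₀ (by norm_num) (card_le_univ I)
  calc ((2 ^ I.card : ℕ) : ℝ) * 𝔼 x, ind (r x ≠ P x) ≤
      2 ^ Fintype.card ι * ((1 / 2) ^ Fintype.card ι * (1 / 8)) :=
        mul_le_mul hI hP (expect_nonneg fun _ _ => ind_nonneg _) (by positivity)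
    _ = 1 / 8 := by rw [← mul_assoc, ← mul_pow]; norm_num

lemma boost_fact {E : Fm n} (hE : Fam E) {P : XX n → ZMod 2} (hP : FactE E P) (ω : Finset ι)
    (y y' a a' : XX n) (hy : ∀ p ∈ E, p.2 y = p.2 y') (ha : ∀ s ∈ idx E, hh s y a = hh s y' a') :
    P (ω.piecewise (y + a) a) = P (ω.piecewise (y' + a') a') := by
  apply hP
  intro p hp
  have hf := (hE p hp).2
  have key : ∀ y a : XX n, p.2 (ω.piecewise (y + a) a) =
      ∑ T ∈ (ω ∩ p.1).powerset, p.2 (T.piecewise y a) := by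
    intro y a
    rw [cube_sub hf _ inter_subset_right]
    apply hf.dep
    intro i hi
    by_cases h : i ∈ ω <;> simp [h, hi, add_comm]
  rw [key, key]
  apply sum_congr rfl
  intro T hT
  have hT1 : T ⊆ p.1 := (mem_powerset.mp hT).trans inter_subset_right
  by_cases hTe : T = p.1
  · have : ∀ y a : XX n, p.2 (T.piecewise y a) = p.2 y := by
      intro y a
      apply hf.dep
      intro i hi
      simp [hTe, hi]
    rw [this, this, hy p hp]
  · exact ha (p, T) (mem_filter.mpr ⟨mem_product.mpr ⟨hp, mem_univ _⟩, hT1.ssubset_of_ne hTe⟩)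

lemma claim3 {E : Fm n} (hE : Fam E) {I : Finset ι} {r : XX n → ZMod 2} (hr : IsForm I r)
    {P : XX n → ZMod 2} (hP : FactE E P)
    (hPr : 𝔼 x, ind (r x ≠ P x) ≤ (1 / 2) ^ Fintype.card ι * (1 / 8))
    {κ1 : ℝ} (hκ1 : 0 ≤ κ1) (hκ : κ1 ≤ 1 / 2 * (1 / 2) ^ (idx E).card) {y y' : XX n}
    (hy : Good E κ1 y) (hy' : Good E κ1 y') (hyy : ∀ p ∈ E, p.2 y = p.2 y') : r y = r y' := by
  obtain ⟨a, a', h1, h2, h3⟩ := pigeon (fun s a => hh s y a) (fun s a => hh s y' a) (idx E) κ1 hκ1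
    hκ hy hy' _ _ (boost_err hr P hPr y) (boost_err hr P hPr y')
  simp only [not_not] at h2 h3
  rw [← h2, ← h3]
  apply sum_congr rfl
  intro ω _
  exact boost_fact hE hP ω y y' a a' hyy h1

end TP


namespace TP

open scoped BigOperators
open Function

set_option linter.unusedSectionVars false
set_option linter.unusedVariables false

variable {ι : Type} [Fintype ι] [DecidableEq ι] {n : ι → ℕ}

def att (E : Fm n) (x : XX n) : Fm n := E.filter (fun p => p.2 x = 1)

lemma mem_att {E : Fm n} {x : XX n} {p} : p ∈ att E x ↔ p ∈ E ∧ p.2 x = 1 := mem_filter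

lemma att_eq {E : Fm n} {x y : XX n} (h : att E x = att E y) : ∀ p ∈ E, p.2 x = p.2 y := by
  intro p hp
  have e : p ∈ att E x ↔ p ∈ att E y := by rw [h]
  simp only [mem_att, hp, true_and] at e
  rcases zmod2_cases (p.2 x) with h3 | h3 <;> rcases zmod2_cases (p.2 y) with h4 | h4 <;>
    simp_all

lemma atoms_ind {α Y : Type*} [Fintype Y] [Nonempty Y] [DecidableEq α] (h : α → Y → ZMod 2)
    (T : Finset α) (κ : ℝ) (hκ : 0 ≤ κ)
    (H : ∀ S ⊆ T, S.Nonempty → |𝔼 y, sg (∑ a ∈ S, h a y)| ≤ κ) (c : α → ZMod 2) :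
    |𝔼 y, ind (∀ a ∈ T, h a y = c a) - (1 / 2) ^ T.card| ≤ κ := by
  simp_rw [ind_ite]
  exact atoms h T κ hκ H c

lemma claim4 {E : Fm n} {ν κ τ : ℝ} (hE : Reg E ν) (hκ : 0 ≤ κ)
    (hν : ν ≤ κ ^ (2 ^ Fintype.card ι)) (good : XX n → Prop) (hbad : 𝔼 y, ind (¬ good y) ≤ τ)
    (hτ : κ + 3 * τ < (1 / 2) ^ (2 * E.card)) (i : ι) (U A B : Fm n) (hU : U ⊆ E) (hA : A ⊆ E)
    (hB : B ⊆ E) (hUi : ∀ p ∈ U, i ∉ p.1) (hAi : ∀ p ∈ A, i ∈ p.1) (hBi : ∀ p ∈ B, i ∈ p.1) :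
    ∃ x y : XX n, good x ∧ good (update x i (y i)) ∧ good (update x i (x i + y i)) ∧
      att E x = U ∪ A ∧ att E (update x i (y i)) = U ∪ B ∧
      att E (update x i (x i + y i)) = U ∪ (symmDiff A B) := by
  classical
  set T1 := E.image (fun p => (p, (0 : ι → Fin 3))) with hT1
  set T2 := (E.filter (fun p => i ∈ p.1)).image (fun p => (p, (Pi.single i 1 : ι → Fin 3))) with hT2
  have hTc : (T1 ∪ T2).card ≤ 2 * E.card := by
    have h1 : T1.card ≤ E.card := card_image_le
    have h2 : T2.card ≤ E.card := card_image_le.trans (card_filter_le _ _)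
    have h3 := card_union_le T1 T2
    omega
  have hTs : ∀ s ∈ T1 ∪ T2, s.1 ∈ E ∧ ∀ j ∉ s.1.1, s.2 j = 0 := by
    intro s hs
    rcases mem_union.mp hs with hs | hs
    · obtain ⟨p, hp, rfl⟩ := mem_image.mp hs
      exact ⟨hp, fun _ _ => rfl⟩
    · obtain ⟨p, hp, rfl⟩ := mem_image.mp hs
      obtain ⟨hp, hpi⟩ := mem_filter.mp hp
      refine ⟨hp, fun j hj => ?_⟩
      have : j ≠ i := by rintro rfl; exact hj hpi
      simp [this]
  have hat := atoms_ind (Y := XX n × XX n × XX n)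
    (fun (s : (Finset ι × (XX n → ZMod 2)) × (ι → Fin 3)) w => s.1.2 (fun i =>
      if s.2 i = 0 then w.1 i else if s.2 i = 1 then w.2.1 i else w.2.2 i)) (T1 ∪ T2) κ hκ
    (fun S hS hne => colored_le hE hκ hν S hne (fun s hs => hTs s (hS hs)))
    (fun s => if s.2 = 0 then (if s.1 ∈ U ∪ A then 1 else 0) else (if s.1 ∈ B then 1 else 0))
  set Ev : XX n × XX n × XX n → Prop := fun w => ∀ s ∈ T1 ∪ T2, s.1.2 (fun i =>
      if s.2 i = 0 then w.1 i else if s.2 i = 1 then w.2.1 i else w.2.2 i) =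
      if s.2 = 0 then (if s.1 ∈ U ∪ A then 1 else 0) else (if s.1 ∈ B then 1 else 0) with hEv
  have hlow : (1 / 2) ^ (2 * E.card) - κ ≤ 𝔼 w, ind (Ev w) := by
    have h1 := (abs_le.mp hat).1
    have h2 : ((1 : ℝ) / 2) ^ (2 * E.card) ≤ (1 / 2) ^ (T1 ∪ T2).card :=
      pow_le_pow_of_le_one (by norm_num) (by norm_num) hTc
    linarith
  have hw : ∃ w, Ev w ∧ good w.1 ∧ good (update w.1 i (w.2.1 i)) ∧
      good (update w.1 i (w.1 i + w.2.1 i)) := by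
    by_contra hcon
    push Not at hcon
    have hpt : ∀ w, ind (Ev w) ≤ ind (¬ good w.1) + ind (¬ good (update w.1 i (w.2.1 i))) +
        ind (¬ good (update w.1 i (w.1 i + w.2.1 i))) := by
      intro w
      refine le_trans (ind_mono (q := (¬ good w.1 ∨ ¬ good (update w.1 i (w.2.1 i))) ∨
        ¬ good (update w.1 i (w.1 i + w.2.1 i))) ?_) ((ind_or _ _).trans ?_)
      · intro h
        have := hcon w h
        tauto
      · have := ind_or (¬ good w.1) (¬ good (update w.1 i (w.2.1 i)))
        linarith
    have h1 : 𝔼 w, ind (Ev w) ≤ 3 * τ := by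
      refine (expect_le_expect fun w _ => hpt w).trans ?_
      rw [expect_add_distrib, expect_add_distrib]
      have e1 := ex_push (fun w : XX n × XX n × XX n => w.1) (fun x => (x, 0, 0))
        (fun _ _ => rfl) (fun y => ind (¬ good y))
      have e2 := ex_push (fun w : XX n × XX n × XX n => update w.1 i (w.2.1 i))
        (fun x => (x, x, 0)) (fun w x => by
          funext j
          by_cases hj : j = i
          · subst hj; simp
          · simp [hj]) (fun y => ind (¬ good y))
      have e3 := ex_push (fun w : XX n × XX n × XX n => update w.1 i (w.1 i + w.2.1 i))
        (fun x => (x, 0, 0)) (fun w x => by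
          funext j
          by_cases hj : j = i
          · subst hj; simp only [Prod.fst_add, Prod.snd_add, update_self, Pi.add_apply]
            abel
          · simp [hj]) (fun y => ind (¬ good y))
      rw [e1, e2, e3]
      linarith
    linarith
  obtain ⟨⟨x, y, y'⟩, hev, hg1, hg2, hg3⟩ := hw
  simp only at hg1 hg2 hg3
  have v1 : ∀ p ∈ E, p.2 x = if p ∈ U ∪ A then 1 else 0 := by
    intro p hp
    have := hev (p, 0) (mem_union_left _ (mem_image_of_mem _ hp))
    simpa using this
  have v2 : ∀ p ∈ E, i ∈ p.1 → p.2 (update x i (y i)) = if p ∈ B then 1 else 0 := by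
    intro p hp hpi
    have := hev (p, Pi.single i 1) (mem_union_right _
      (mem_image.mpr ⟨p, mem_filter.mpr ⟨hp, hpi⟩, rfl⟩))
    have hne : (Pi.single i 1 : ι → Fin 3) ≠ 0 := by
      intro h
      have := congrFun h i
      simp at this
    simp only [hne, if_false] at this
    rw [← this]
    refine congrArg p.2 ?_
    funext j
    by_cases hj : j = i
    · subst hj; simp
    · simp [hj]
  have v3 : ∀ p ∈ E, i ∉ p.1 → ∀ t, p.2 (update x i t) = p.2 x := by
    intro p hp hpi t
    apply (hE.1 p hp).2.dep
    intro j hj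
    rw [update_of_ne]
    rintro rfl; exact hpi hj
  have v4 : ∀ p ∈ E, i ∈ p.1 → p.2 (update x i (x i + y i)) =
      p.2 x + p.2 (update x i (y i)) := by
    intro p hp hpi
    rw [(hE.1 p hp).2.add i hpi, update_eq_self]
  have h10 : ¬ ((0 : ZMod 2) = 1) := by decide
  have h11 : (1 : ZMod 2) + 1 = 0 := by decide
  refine ⟨x, y, hg1, hg2, hg3, ?_, ?_, ?_⟩
  · ext p
    rw [mem_att]
    constructor
    · rintro ⟨hp, h⟩
      rw [v1 p hp] at h
      by_contra hc
      rw [if_neg hc] at h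
      exact h10 h
    · intro hp
      have hpE := union_subset hU hA hp
      exact ⟨hpE, by rw [v1 p hpE, if_pos hp]⟩
  · ext p
    rw [mem_att]
    by_cases hpE : p ∈ E
    · by_cases hpi : i ∈ p.1
      · have h1 : p ∉ U := fun h => hUi p h hpi
        rw [v2 p hpE hpi]
        by_cases hpB : p ∈ B <;> simp [hpE, h1, hpB]
      · have h1 : p ∉ A := fun h => hpi (hAi p h)
        have h2 : p ∉ B := fun h => hpi (hBi p h)
        rw [v3 p hpE hpi, v1 p hpE]
        by_cases hpU : p ∈ U <;> simp [hpE, h1, h2, hpU]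
    · have h1 : p ∉ U := fun h => hpE (hU h)
      have h2 : p ∉ B := fun h => hpE (hB h)
      simp [hpE, h1, h2]
  · ext p
    rw [mem_att]
    by_cases hpE : p ∈ E
    · by_cases hpi : i ∈ p.1
      · have h1 : p ∉ U := fun h => hUi p h hpi
        rw [v4 p hpE hpi, v2 p hpE hpi, v1 p hpE]
        by_cases hpB : p ∈ B <;> by_cases hpA : p ∈ A <;>
          simp [hpE, h1, hpB, hpA, mem_symmDiff, h11]
      · have h1 : p ∉ A := fun h => hpi (hAi p h)
        have h2 : p ∉ B := fun h => hpi (hBi p h)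
        rw [v3 p hpE hpi, v1 p hpE]
        by_cases hpU : p ∈ U <;> simp [hpE, h1, h2, hpU, mem_symmDiff]
    · have h1 : p ∉ U := fun h => hpE (hU h)
      have h2 : p ∉ B := fun h => hpE (hB h)
      have h3 : p ∉ A := fun h => hpE (hA h)
      simp [hpE, h1, h2, h3, mem_symmDiff]

lemma mobius {α : Type*} [DecidableEq α] (G : Finset α → ZMod 2) (A : Finset α) :
    ∑ T ∈ A.powerset, ∑ S ∈ T.powerset, G S = G A := by
  rw [sum_comm' (t' := A.powerset) (s' := fun S => Icc S A)]
  · rw [sum_eq_single A]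
    · simp
    · intro S hS hne
      rw [sum_const, Finset.card_Icc_finset (mem_powerset.mp hS)]
      have hlt : S.card < A.card := card_lt_card ((mem_powerset.mp hS).ssubset_of_ne hne)
      obtain ⟨k, hk⟩ : ∃ k, A.card - S.card = k + 1 := ⟨A.card - S.card - 1, by omega⟩
      rw [hk, pow_succ, mul_nsmul, two_nsmul, zmod2_add_self]
    · simp
  · intro T S
    simp only [mem_powerset, mem_Icc]
    constructor
    · rintro ⟨h1, h2⟩; exact ⟨⟨h2, h1⟩, h2.trans h1⟩
    · rintro ⟨⟨h1, h2⟩, _⟩; exact ⟨h2, h1⟩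

/-- coefficient vanishing -/
lemma coef_part {E : Fm n} {I : Finset ι} (htypes : ∀ p ∈ E, p.1 ⊆ I) (G : Fm n → ZMod 2)
    (hadd : ∀ i ∈ I, ∀ U A B : Fm n, U ⊆ E → A ⊆ E → B ⊆ E → (∀ p ∈ U, i ∉ p.1) →
      (∀ p ∈ A, i ∈ p.1) → (∀ p ∈ B, i ∈ p.1) →
      G (U ∪ symmDiff A B) = G (U ∪ A) + G (U ∪ B)) (T : Fm n) (hT : T ⊆ E)
    (hne : ∑ S ∈ T.powerset, G S ≠ 0) : IsPart T I := by
  have key0 : ∀ i ∈ I, ∃ p ∈ T, i ∈ p.1 := by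
    intro i hi
    by_contra hcon
    push Not at hcon
    apply hne
    apply sum_eq_zero
    intro S hS
    have hS := mem_powerset.mp hS
    have := hadd i hi S ∅ ∅ (hS.trans hT) (empty_subset _) (empty_subset _)
      (fun p hp => hcon p (hS hp)) (by simp) (by simp)
    simpa using this
  have key1 : ∀ i ∈ I, ∀ q ∈ T, ∀ q' ∈ T, i ∈ q.1 → i ∈ q'.1 → q = q' := by
    intro i hi q hq q' hq' hqi hqi'
    by_contra hqq
    apply hne
    have hadd2 : ∀ S ⊆ T.erase q, G S + G (insert q S) =
        G (S.filter (fun p => i ∉ p.1) ∪ {q}) := by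
      intro S hS
      have hSE : S ⊆ E := (hS.trans (erase_subset _ _)).trans hT
      have hqS : q ∉ S := fun h => (mem_erase.mp (hS h)).1 rfl
      have h := hadd i hi (S.filter (fun p => i ∉ p.1)) (S.filter (fun p => i ∈ p.1)) {q}
        ((filter_subset _ _).trans hSE) ((filter_subset _ _).trans hSE)
        (singleton_subset_iff.mpr (hT hq)) (fun p hp => (mem_filter.mp hp).2)
        (fun p hp => (mem_filter.mp hp).2) (by simpa using hqi)
      have e1 : S.filter (fun p => i ∉ p.1) ∪ S.filter (fun p => i ∈ p.1) = S := by
        rw [union_comm]; exact filter_union_filter_not_eq _ _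
      have e2 : S.filter (fun p => i ∉ p.1) ∪ symmDiff (S.filter (fun p => i ∈ p.1)) {q} =
          insert q S := by
        ext p
        simp only [mem_union, mem_filter, mem_symmDiff, mem_singleton, mem_insert]
        by_cases hpq : p = q
        · subst hpq; simp [hqS]
        · simp [hpq]; tauto
      rw [e1, e2] at h
      rw [h, ← add_assoc, zmod2_add_self, zero_add]
    rw [← insert_erase hq, sum_powerset_insert' (notMem_erase _ _), ← sum_add_distrib]
    rw [sum_congr rfl (fun S hS => hadd2 S (mem_powerset.mp hS))]
    have hq'2 : q' ∈ T.erase q := mem_erase.mpr ⟨fun h => hqq h.symm, hq'⟩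
    rw [← insert_erase hq'2, sum_powerset_insert' (notMem_erase _ _), ← sum_add_distrib]
    apply sum_eq_zero
    intro S _
    rw [filter_insert, if_neg (by simpa using hqi'), zmod2_add_self]
  refine ⟨?_, ?_⟩
  · intro p hp q hq hpq
    rw [Finset.disjoint_left]
    intro i h1 h2
    exact hpq (key1 i (htypes p (hT hp) h1) p hp q hq h1 h2)
  · ext i
    rw [mem_biUnion]
    constructor
    · rintro ⟨p, hp, h⟩; exact htypes p (hT hp) h
    · intro hi; exact key0 i hi

end TP


namespace TP

open scoped BigOperators
open Function

set_option linter.unusedSectionVars false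
set_option linter.unusedVariables false

variable {ι : Type} [Fintype ι] [DecidableEq ι] {n : ι → ℕ}

lemma core {E : Fm n} {I : Finset ι} {ν : ℝ} (hE : Reg E ν) (ht : ∀ p ∈ E, p.1 ⊆ I)
    {r : XX n → ZMod 2} (hr : IsForm I r) {P : XX n → ZMod 2} (hP : FactE E P)
    (hPr : 𝔼 x, ind (r x ≠ P x) ≤ (1 / 2) ^ Fintype.card ι * (1 / 8))
    (hν : ν ≤ ((1 / 2) ^ (6 * (E.card * 2 ^ Fintype.card ι) + Fintype.card ι + 8)) ^
      (2 ^ Fintype.card ι)) : r ∈ TP.Poly E I := by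
  classical
  set D := Fintype.card ι with hD
  set M := E.card * 2 ^ D with hM
  set κ : ℝ := (1 / 2) ^ (6 * M + D + 8) with hκd
  set κ1 : ℝ := (1 / 2) ^ (M + 1) with hκ1d
  set τ : ℝ := (1 / 2) ^ (3 * M + D + 6) with hτd
  have hκ : 0 ≤ κ := by positivity
  have hκ1 : 0 < κ1 := by positivity
  have hidx : (idx E).card ≤ M := idx_card E
  have hbad : 𝔼 y, ind (¬ Good E κ1 y) ≤ τ := by
    have h := claim2 hE hκ hκ1 hν
    have h2 : (2 : ℝ) ^ (idx E).card ≤ 2 ^ M := pow_le_pow_right₀ (by norm_num) hidx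
    have h3 : (2 : ℝ) ^ M * κ = κ1 ^ 2 * τ := by
      rw [hκd, hκ1d, hτd, ← pow_mul, ← pow_add, one_div, inv_pow, inv_pow]
      field_simp
      rw [← pow_add]; ring
    have h4 : (2 : ℝ) ^ (idx E).card * κ ≤ κ1 ^ 2 * τ := by
      rw [← h3]; exact mul_le_mul_of_nonneg_right h2 hκ
    exact le_of_mul_le_mul_left (h.trans h4) (by positivity)
  have hEM : E.card ≤ M := Nat.le_mul_of_pos_right _ (by positivity)
  have hτ : κ + 3 * τ < (1 / 2) ^ (2 * E.card) := by
    have h1 : κ ≤ τ := pow_le_pow_of_le_one (by norm_num) (by norm_num) (by omega)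
    have h2 : τ * 8 ≤ (1 / 2) ^ (2 * E.card) := by
      have : τ * 8 = (1 / 2) ^ (3 * M + D + 3) := by
        rw [hτd, show 3 * M + D + 6 = (3 * M + D + 3) + 3 by ring, pow_add]; ring
      rw [this]
      exact pow_le_pow_of_le_one (by norm_num) (by norm_num) (by omega)
    have : 0 < τ := by positivity
    linarith
  have hκ12 : κ1 ≤ 1 / 2 * (1 / 2) ^ (idx E).card := by
    rw [← pow_succ']
    exact pow_le_pow_of_le_one (by norm_num) (by norm_num) (by omega)
  have hcl3 : ∀ y y', Good E κ1 y → Good E κ1 y' → att E y = att E y' → r y = r y' :=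
    fun y y' h h' hh => claim3 hE.1 hr hP hPr hκ1.le hκ12 h h' (att_eq hh)
  set G : Fm n → ZMod 2 := fun A =>
    if h : ∃ y, Good E κ1 y ∧ att E y = A then r h.choose else 0 with hG
  have hGr : ∀ y, Good E κ1 y → r y = G (att E y) := by
    intro y hy
    have h : ∃ y', Good E κ1 y' ∧ att E y' = att E y := ⟨y, hy, rfl⟩
    simp only [hG]
    rw [dif_pos h]
    exact hcl3 _ _ hy h.choose_spec.1 h.choose_spec.2.symm
  have hadd : ∀ i ∈ I, ∀ U A B : Fm n, U ⊆ E → A ⊆ E → B ⊆ E → (∀ p ∈ U, i ∉ p.1) →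
      (∀ p ∈ A, i ∈ p.1) → (∀ p ∈ B, i ∈ p.1) →
      G (U ∪ symmDiff A B) = G (U ∪ A) + G (U ∪ B) := by
    intro i hi U A B hU hA hB hUi hAi hBi
    obtain ⟨x, y, g1, g2, g3, a1, a2, a3⟩ := claim4 hE hκ hν (Good E κ1) hbad hτ i U A B hU hA hB
      hUi hAi hBi
    rw [← a1, ← a2, ← a3, ← hGr _ g1, ← hGr _ g2, ← hGr _ g3, hr.add i hi, update_eq_self]
  set g0 : XX n → ZMod 2 := ∑ T ∈ E.powerset, (∑ S ∈ T.powerset, G S) • ∏ p ∈ T, p.2 with hg0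
  have hg0P : g0 ∈ TP.Poly E I := by
    refine Submodule.sum_mem _ fun T hT => ?_
    by_cases h : ∑ S ∈ T.powerset, G S = 0
    · rw [h, zero_smul]; exact Submodule.zero_mem _
    · exact Submodule.smul_mem _ _ (poly_gen (mem_powerset.mp hT)
        (coef_part ht G hadd T (mem_powerset.mp hT) h))
  have hg0v : ∀ y, g0 y = G (att E y) := by
    intro y
    rw [← mobius G (att E y), hg0, Finset.sum_apply]
    symm
    have hsub : (att E y).powerset ⊆ E.powerset := powerset_mono.mpr (filter_subset _ _)
    rw [← sum_subset_zero_on_sdiff hsub (f := fun T => ∑ S ∈ T.powerset, G S)]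
    · intro T hT
      obtain ⟨hT1, hT2⟩ := mem_sdiff.mp hT
      rw [mem_powerset] at hT1 hT2
      obtain ⟨p, hp, hp2⟩ := not_subset.mp hT2
      have : p.2 y = 0 := by
        rcases zmod2_cases (p.2 y) with h | h
        · exact h
        · exact absurd (mem_att.mpr ⟨hT1 hp, h⟩) hp2
      rw [Pi.smul_apply, Finset.prod_apply, prod_eq_zero hp this, smul_zero]
    · intro T hT
      rw [mem_powerset] at hT
      rw [Pi.smul_apply, Finset.prod_apply, prod_eq_one, smul_eq_mul, mul_one]
      intro p hp
      exact (mem_att.mp (hT hp)).2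
  have hz : r + g0 = 0 := by
    by_contra hne
    have h := form_density (hr.fadd (poly_form hE.1 hg0P)) hne
    have h1 : 𝔼 x, (if (r + g0) x ≠ 0 then (1 : ℝ) else 0) ≤ τ := by
      refine le_trans (expect_le_expect fun x _ => ?_) hbad
      by_cases hx : Good E κ1 x
      · rw [if_neg]
        · exact ind_nonneg _
        · rw [not_not, Pi.add_apply, hg0v, ← hGr x hx, zmod2_add_self]
      · rw [ind_pos hx]; split_ifs <;> norm_num
    have h2 : (2 : ℝ) ^ I.card ≤ 2 ^ D := pow_le_pow_right₀ (by norm_num) (card_le_univ I)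
    have h3 : (2 : ℝ) ^ I.card * 𝔼 x, (if (r + g0) x ≠ 0 then (1 : ℝ) else 0) ≤ 2 ^ D * τ :=
      mul_le_mul h2 h1 (expect_nonneg fun x _ => by split_ifs <;> norm_num) (by positivity)
    have h4 : (2 : ℝ) ^ D * τ ≤ 1 / 2 := by
      have : (2 : ℝ) ^ D * τ = (1 / 2) ^ (3 * M + 6) := by
        rw [hτd, one_div, inv_pow, inv_pow]
        field_simp
        rw [← pow_add]; ring
      rw [this]
      calc ((1 : ℝ) / 2) ^ (3 * M + 6) ≤ (1 / 2) ^ 1 :=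
            pow_le_pow_of_le_one (by norm_num) (by norm_num) (by omega)
        _ = _ := by norm_num
    linarith
  have : r = g0 := by
    have : r + g0 + g0 = g0 := by rw [hz, zero_add]
    rwa [add_assoc, fun_add_self, add_zero] at this
  rw [this]; exact hg0P

lemma slice_form {I ω : Finset ι} {r : XX n → ZMod 2} (hr : IsForm I r) (a : XX n) :
    IsForm (I \ ω) (fun x => r (ω.piecewise a x)) := by
  constructor
  · intro x y h
    apply hr.dep
    intro i hi
    by_cases hω : i ∈ ω
    · simp [hω]
    · simp [hω, h i (mem_sdiff.mpr ⟨hi, hω⟩)]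
  · intro i hi x b c
    obtain ⟨hi, hω⟩ := mem_sdiff.mp hi
    have : ∀ t, ω.piecewise a (update x i t) = update (ω.piecewise a x) i t := by
      intro t
      funext j
      by_cases hj : j = i
      · subst hj; simp [hω]
      · by_cases hjω : j ∈ ω <;> simp [hj, hjω]
    simp only [this]
    exact hr.add i hi _ _ _

lemma reg_empty {ν : ℝ} : Reg (∅ : Fm n) ν :=
  ⟨by simp [Fam], fun I S hS hne => absurd (subset_empty.mp hS) hne.ne_empty⟩

lemma BR_step (j : ℕ) (hj : 0 < j) (ih : ∀ i, 0 < i → i < j → BR ι i) : BR ι j := by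
  classical
  intro c hc
  set D := Fintype.card ι with hD
  obtain ⟨L, hL⟩ := predictor (ι := ι) c ((1 / 2) ^ D * (1 / 8)) hc (by positivity)
  set Φ : ℕ → ℝ := fun N => ((1 / 2) ^ (6 * (N * 2 ^ D) + D + 8)) ^ (2 ^ D) with hΦ
  have hΦa : Antitone Φ := by
    intro a b hab
    apply pow_le_pow_left₀ (by positivity)
    apply pow_le_pow_of_le_one (by norm_num) (by norm_num)
    have := Nat.mul_le_mul_right (2 ^ D) hab
    omega
  obtain ⟨C, ψ, hψ, hC⟩ := SS_all j ih (L * 2 ^ D) Φ (fun k => by positivity) hΦa (L * 2 ^ D)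
  refine ⟨C, fun n I hI r hr hcr => ?_⟩
  obtain ⟨a, P, hP, hPr⟩ := hL n r hcr
  set W : Finset (ℕ × Finset ι) := range L ×ˢ (I.powerset.filter (fun ω => ω ≠ ∅ ∧ ω ≠ I)) with hW
  set Q : Fm n := W.image (fun w => (I \ w.2, fun x => r (w.2.piecewise (a w.1) x))) with hQ
  have hQc : Q.card ≤ L * 2 ^ D := by
    refine card_image_le.trans ?_
    rw [hW, card_product, card_range]
    refine Nat.mul_le_mul_left _ ((card_filter_le _ _).trans ?_)
    rw [card_powerset]
    exact Nat.pow_le_pow_right (by norm_num) (card_le_univ I)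
  have hQs : ∀ q ∈ Q, q.1 ⊂ I ∧ q.1.Nonempty ∧ IsForm q.1 q.2 := by
    intro q hq
    obtain ⟨w, hw, rfl⟩ := mem_image.mp hq
    obtain ⟨_, h2⟩ := mem_product.mp hw
    obtain ⟨h2, h3, h4⟩ := mem_filter.mp h2
    rw [mem_powerset] at h2
    refine ⟨?_, ?_, slice_form hr _⟩
    · exact sdiff_ssubset h2 (nonempty_iff_ne_empty.mpr h3)
    · rw [sdiff_nonempty]
      exact fun h => h4 (h2.antisymm h)
  obtain ⟨E', -, hE'c, hE'r, hE'Q, hE't⟩ := hC n ∅ Q (by simpa using hQc)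
    (fun q hq => (hQs q hq).2) (fun q hq => hI ▸ card_lt_card (hQs q hq).1)
    ((card_filter_le _ _).trans hQc) reg_empty
  have htt : ∀ p ∈ E', p.1 ⊂ I := by
    intro p hp
    rcases hE't p hp with h | ⟨q, hq, h⟩
    · simp at h
    · exact lt_of_le_of_lt h (hQs q hq).1
  refine ⟨E', hE'c, hE'r.1, htt, ?_⟩
  have hFP : FactE E' P := by
    intro x y hxy
    apply hP
    intro l hl
    rw [← cube_form hr x (a l), ← cube_form hr y (a l)]
    have key : ∀ x : XX n, ∑ ω ∈ I.powerset, r (ω.piecewise (a l) x) + r x =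
        ∑ ω ∈ I.powerset.erase ∅, r (ω.piecewise (a l) x) := by
      intro x
      rw [← add_sum_erase _ _ (empty_mem_powerset I), piecewise_empty, add_comm, ← add_assoc,
        zmod2_add_self, zero_add]
    rw [key, key]
    refine sum_congr rfl fun ω hω => ?_
    obtain ⟨hω0, hωI⟩ := mem_erase.mp hω
    by_cases hωe : ω = I
    · subst hωe
      apply hr.dep
      intro i hi
      simp [hi]
    · have hq : ((I \ ω, fun x => r (ω.piecewise (a l) x)) : Finset ι × (XX n → ZMod 2)) ∈ Q :=
        mem_image.mpr ⟨(l, ω), mem_product.mpr ⟨mem_range.mpr hl,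
          mem_filter.mpr ⟨hωI, hω0, hωe⟩⟩, rfl⟩
      exact poly_fact (hE'Q _ hq) x y hxy
  exact core hE'r (fun p hp => (htt p hp).1) hr hFP hPr le_rfl

lemma BR_all (j : ℕ) (hj : 0 < j) : BR ι j := by
  induction j using Nat.strong_induction_on with
  | _ j ih => exact BR_step j hj fun i h0 hi => ih i hi h0

lemma SS_every (j t : ℕ) : SS ι j t := SS_all j (fun i h _ => BR_all i h) t

end TP


namespace TP

open scoped BigOperators
open Function

set_option linter.unusedSectionVars false
set_option linter.unusedVariables false

variable {ι : Type} [Fintype ι] [DecidableEq ι] {n : ι → ℕ}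

/-- forms in the ideal generated by F -/
def Idl (F : Fm n) : Submodule (ZMod 2) (XX n → ZMod 2) where
  carrier := {r | ∃ g : (Finset ι × (XX n → ZMod 2)) → XX n → ZMod 2,
    (∀ p ∈ F, ∀ x y : XX n, (∀ i, i ∉ p.1 → x i = y i) → g p x = g p y) ∧
      r = ∑ p ∈ F, p.2 * g p}
  add_mem' := by
    rintro _ _ ⟨g, hg, rfl⟩ ⟨g', hg', rfl⟩
    refine ⟨g + g', fun p hp x y h => ?_, ?_⟩
    · simp only [Pi.add_apply]; rw [hg p hp x y h, hg' p hp x y h]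
    · rw [← sum_add_distrib]; exact sum_congr rfl fun p _ => by rw [Pi.add_apply, mul_add]
  zero_mem' := ⟨0, fun _ _ _ _ _ => rfl, by simp⟩
  smul_mem' := by
    rintro c _ ⟨g, hg, rfl⟩
    refine ⟨c • g, fun p hp x y h => ?_, ?_⟩
    · simp only [Pi.smul_apply]; rw [hg p hp x y h]
    · rw [smul_sum]; exact sum_congr rfl fun p _ => by rw [Pi.smul_apply, mul_smul_comm]

lemma idl_part {E T : Fm n} (hT : Fam T) {J : Finset ι} (hTp : IsPart T J) {p} (hp : p ∈ T)
    (hpE : p ∈ E) : ∏ q ∈ T, q.2 ∈ Idl E := by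
  classical
  refine ⟨fun q => if q = p then ∏ q ∈ T.erase p, q.2 else 0, ?_, ?_⟩
  · intro q hq x y h
    by_cases hqp : q = p
    · subst hqp
      simp only [if_true, Finset.prod_apply]
      refine prod_congr rfl fun s hs => ?_
      obtain ⟨h1, h2⟩ := mem_erase.mp hs
      apply (hT s h2).2.dep
      intro i hi
      exact h i (Finset.disjoint_left.mp (hTp.1 s h2 q hp h1) hi)
    · simp [hqp]
  · rw [sum_eq_single p]
    · simp [mul_prod_erase T (fun q : Finset ι × (XX n → ZMod 2) => q.2) hp]
    · intro q _ hqp; simp [hqp]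
    · intro h; exact absurd hpE h

lemma poly_coef {E : Fm n} {J : Finset ι} {r : XX n → ZMod 2} (hr : r ∈ TP.Poly E J) :
    ∃ c : Fm n → ZMod 2, (∀ T, c T ≠ 0 → IsPart T J) ∧
      r = ∑ T ∈ E.powerset, c T • ∏ p ∈ T, p.2 := by
  classical
  induction hr using Submodule.span_induction with
  | mem f hf =>
    obtain ⟨T, hT, hp, rfl⟩ := hf
    refine ⟨Pi.single T 1, fun S hS => ?_, ?_⟩
    · by_cases h : S = T
      · rw [h]; exact hp
      · simp [h] at hS
    · rw [sum_eq_single T]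
      · simp
      · intro S _ h; simp [h]
      · intro h; exact absurd (mem_powerset.mpr hT) h
  | zero => exact ⟨0, by simp, by simp⟩
  | add f g _ _ hf hg =>
    obtain ⟨c, hc, rfl⟩ := hf
    obtain ⟨c', hc', rfl⟩ := hg
    refine ⟨c + c', fun T hT => ?_, ?_⟩
    · by_cases h : c T = 0
      · apply hc'
        simpa [h] using hT
      · exact hc T h
    · rw [← sum_add_distrib]; exact sum_congr rfl fun p _ => by rw [Pi.add_apply, add_smul]
  | smul a f _ hf =>
    obtain ⟨c, hc, rfl⟩ := hf
    refine ⟨a • c, fun T hT => hc T fun h => hT (by simp [h]), ?_⟩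
    rw [smul_sum]; exact sum_congr rfl fun p _ => by rw [Pi.smul_apply, smul_eq_mul, mul_smul]

lemma part_unique {T T0 : Fm n} {J : Finset ι} (hT : Fam T) (h : IsPart T J) (h0 : IsPart T0 J)
    (hs : T0 ⊆ T) : T0 = T := by
  refine hs.antisymm fun p hp => ?_
  obtain ⟨i, hi⟩ := (hT p hp).1
  have : i ∈ T0.biUnion Prod.fst := by
    rw [h0.2, ← h.2]; exact mem_biUnion.mpr ⟨p, hp, hi⟩
  obtain ⟨q, hq, hiq⟩ := mem_biUnion.mp this
  by_cases hpq : p = q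
  · rw [hpq]; exact hq
  · exact absurd hiq (Finset.disjoint_left.mp (h.1 p hp q (hs hq) hpq) hi)

lemma part_card {T : Fm n} {J : Finset ι} (hT : Fam T) (h : IsPart T J) :
    T.card ≤ Fintype.card ι := by
  calc T.card ≤ ∑ p ∈ T, p.1.card := by
        rw [card_eq_sum_ones]
        exact sum_le_sum fun p hp => (hT p hp).1.card_pos
    _ = (T.biUnion Prod.fst).card := (card_biUnion (fun p hp q hq hpq => h.1 p hp q hq hpq)).symm
    _ ≤ _ := card_le_univ _

/-- toggling sum -/
lemma toggle {α : Type*} [DecidableEq α] (c : Finset α → ZMod 2) (E T0 : Finset α) (hT0 : T0 ⊆ E)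
    (h1 : c T0 = 1) (h2 : ∀ T ⊆ E, c T ≠ 0 → T0 ⊆ T → T = T0) (A : Finset α) :
    ∃ B ⊆ T0, ∑ T ∈ E.powerset, (if T ⊆ symmDiff A B then c T else 0) = 1 := by
  have key : ∑ B ∈ T0.powerset, ∑ T ∈ E.powerset, (if T ⊆ symmDiff A B then c T else 0) = 1 := by
    rw [sum_comm, sum_eq_single T0]
    · rw [sum_eq_single (T0 \ A)]
      · rw [if_pos, h1]
        intro p hp
        rw [mem_symmDiff, mem_sdiff]; tauto
      · intro B hB hne
        rw [if_neg]
        intro h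
        apply hne
        rw [mem_powerset] at hB
        ext p
        rw [mem_sdiff]
        constructor
        · intro hp
          have := mem_symmDiff.mp (h (hB hp))
          tauto
        · rintro ⟨hp, hpA⟩
          have := mem_symmDiff.mp (h hp)
          tauto
      · intro h; exact absurd (mem_powerset.mpr sdiff_subset) h
    · intro T hT hne
      by_cases hc : c T = 0
      · simp [hc]
      · obtain ⟨p, hp, hpT⟩ := not_subset.mp (fun h => hne (h2 T (mem_powerset.mp hT) hc h))
        rw [← insert_erase hp, sum_powerset_insert' (notMem_erase _ _), ← sum_add_distrib]
        apply sum_eq_zero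
        intro B hB
        have hpB : p ∉ B := fun h => (mem_erase.mp (mem_powerset.mp hB h)).1 rfl
        have : T ⊆ symmDiff A (insert p B) ↔ T ⊆ symmDiff A B := by
          simp only [subset_iff, mem_symmDiff, mem_insert]
          constructor
          · intro h q hq
            have := h hq
            have : q ≠ p := fun h => hpT (h ▸ hq)
            tauto
          · intro h q hq
            have := h hq
            have : q ≠ p := fun h => hpT (h ▸ hq)
            tauto
        simp only [this]
        exact zmod2_add_self _
    · intro h; exact absurd (mem_powerset.mpr hT0) h
  by_contra hcon
  push Not at hcon
  rw [sum_eq_zero] at key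
  · exact absurd key (by decide)
  · intro B hB
    rcases zmod2_cases (∑ T ∈ E.powerset, (if T ⊆ symmDiff A B then c T else 0)) with h | h
    · exact h
    · exact absurd h (hcon B (mem_powerset.mp hB))

lemma ex_att {E : Fm n} (Ψ : Fm n → ℝ) :
    𝔼 x, Ψ (att E x) = ∑ A ∈ E.powerset, (𝔼 x, ind (att E x = A)) * Ψ A := by
  classical
  simp_rw [expect_mul]
  rw [← expect_sum_comm]
  refine expect_congr rfl fun x _ => ?_
  rw [sum_eq_single (att E x)]
  · rw [ind_pos rfl, one_mul]
  · intro A _ hA; rw [ind_neg (Ne.symm hA), zero_mul]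
  · intro h; exact absurd (mem_powerset.mpr (filter_subset _ _)) h

lemma att_prob {E : Fm n} {κ : ℝ} (hκ : 0 ≤ κ)
    (H : ∀ S ⊆ E, S.Nonempty → |𝔼 x, sg (∑ p ∈ S, p.2 x)| ≤ κ) {A : Fm n} (hA : A ⊆ E) :
    |𝔼 x, ind (att E x = A) - (1 / 2) ^ E.card| ≤ κ := by
  classical
  have := atoms_ind (fun (p : Finset ι × (XX n → ZMod 2)) (x : XX n) => p.2 x) E κ hκ H
    (fun p => if p ∈ A then 1 else 0)
  convert this using 6 with x
  constructor
  · rintro rfl p hp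
    by_cases h : p.2 x = 1
    · rw [if_pos (mem_att.mpr ⟨hp, h⟩), h]
    · rw [if_neg (fun h' => h (mem_att.mp h').2)]
      exact (zmod2_cases _).resolve_right h
  · intro h
    ext p
    rw [mem_att]
    constructor
    · rintro ⟨hp, h1⟩
      by_contra hpA
      rw [h p hp, if_neg hpA] at h1
      exact absurd h1 (by decide)
    · intro hp
      exact ⟨hA hp, by rw [h p (hA hp), if_pos hp]⟩

lemma lemK {E E' : Fm n} (hEE : E ⊆ E') (hE' : Fam E') {κ : ℝ} (hκ : 0 ≤ κ)
    (hκ2 : κ ≤ 1 / 3 * (1 / 2) ^ E'.card)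
    (H : ∀ S ⊆ E', S.Nonempty → |𝔼 x, sg (∑ p ∈ S, p.2 x)| ≤ κ) {r : XX n → ZMod 2}
    (hr : r ∈ TP.Poly E' univ) (hrI : r ∉ Idl E) {w : XX n → ℝ} (hw0 : ∀ x, 0 ≤ w x)
    (hw : FactE E w) :
    𝔼 x, w x ≤ 2 ^ (Fintype.card ι + 1) * 𝔼 x, w x * ind (r x ≠ 0) := by
  classical
  obtain ⟨c, hc, hrc⟩ := poly_coef hr
  have hex : ∃ T0 ⊆ E', c T0 = 1 ∧ ∀ p ∈ T0, p ∉ E := by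
    by_contra hcon
    push Not at hcon
    apply hrI
    rw [hrc]
    refine Submodule.sum_mem _ fun T hT => ?_
    rw [mem_powerset] at hT
    rcases zmod2_cases (c T) with h | h
    · rw [h, zero_smul]; exact Submodule.zero_mem _
    · obtain ⟨p, hp, hpE⟩ := hcon T hT h
      exact Submodule.smul_mem _ _ (idl_part (fun q hq => hE' q (hT hq))
        (hc T (by rw [h]; decide)) hp hpE)
  obtain ⟨T0, hT0, hcT0, hT0E⟩ := hex
  have hP0 : IsPart T0 univ := hc T0 (by rw [hcT0]; decide)
  set R : Fm n → ZMod 2 := fun A => ∑ T ∈ E'.powerset, (if T ⊆ A then c T else 0) with hR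
  have hrR : ∀ x, r x = R (att E' x) := by
    intro x
    rw [hrc, Finset.sum_apply]
    refine sum_congr rfl fun T hT => ?_
    rw [mem_powerset] at hT
    rw [Pi.smul_apply, Finset.prod_apply]
    by_cases h : T ⊆ att E' x
    · rw [if_pos h, prod_eq_one, smul_eq_mul, mul_one]
      exact fun p hp => (mem_att.mp (h hp)).2
    · rw [if_neg h]
      obtain ⟨p, hp, hp2⟩ := not_subset.mp h
      rw [prod_eq_zero hp, smul_zero]
      exact (zmod2_cases _).resolve_right fun h1 => hp2 (mem_att.mpr ⟨hT hp, h1⟩)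
  have htog : ∀ A, ∃ B ⊆ T0, R (symmDiff A B) = 1 := fun A =>
    toggle c E' T0 hT0 hcT0 (fun T hT hcT hTT =>
      (part_unique (fun q hq => hE' q (hT hq)) (hc T hcT) hP0 hTT).symm) A
  set q : Fm n → ℝ := fun A => 𝔼 x, ind (att E' x = A) with hq
  have hqb : ∀ A ⊆ E', 2 / 3 * (1 / 2) ^ E'.card ≤ q A ∧ q A ≤ 4 / 3 * (1 / 2) ^ E'.card := by
    intro A hA
    have := abs_le.mp (att_prob hκ H hA)
    constructor <;> simp only [hq] <;> linarith [this.1, this.2]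
  have hexx : ∀ A ⊆ E', ∃ x, att E' x = A := by
    intro A hA
    by_contra hcon
    push Not at hcon
    have h1 := (hqb A hA).1
    have h2 : q A = 0 := by
      simp only [hq]
      exact (expect_congr rfl fun x _ => ind_neg (hcon x)).trans (by simp)
    have : (0 : ℝ) < (1 / 2) ^ E'.card := by positivity
    linarith
  choose! xs hxs using hexx
  set W : Fm n → ℝ := fun A => w (xs A) with hWd
  have hsym : ∀ A ⊆ E', ∀ B ⊆ T0, symmDiff A B ⊆ E' := by
    intro A hA B hB p hp
    rcases mem_symmDiff.mp hp with h | h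
    · exact hA h.1
    · exact hT0 (hB h.1)
  have hWw : ∀ x, w x = W (att E' x) := by
    intro x
    have hs : att E' x ⊆ E' := filter_subset _ _
    exact hw _ _ fun p hp => att_eq (hxs _ hs).symm p (hEE hp)
  have hWB : ∀ A ⊆ E', ∀ B ⊆ T0, W (symmDiff A B) = W A := by
    intro A hA B hB
    apply hw
    intro p hp
    have h1 : p ∈ att E' (xs (symmDiff A B)) ↔ p ∈ att E' (xs A) := by
      rw [hxs A hA, hxs _ (hsym A hA B hB), mem_symmDiff]
      have : p ∉ B := fun h => hT0E p (hB h) hp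
      tauto
    rw [mem_att, mem_att] at h1
    have h1 : p.2 (xs (symmDiff A B)) = 1 ↔ p.2 (xs A) = 1 := by
      have := hEE hp
      tauto
    rcases zmod2_cases (p.2 (xs (symmDiff A B))) with h2 | h2
    · rw [h2]
      refine ((zmod2_cases _).resolve_right fun h => ?_).symm
      rw [h1.mpr h] at h2
      exact absurd h2 (by decide)
    · rw [h2, h1.mp h2]
  have hW0 : ∀ A, 0 ≤ W A := fun A => hw0 _
  have e1 : 𝔼 x, w x = ∑ A ∈ E'.powerset, q A * W A := by
    rw [← ex_att]; exact expect_congr rfl fun x _ => hWw x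
  have e2 : 𝔼 x, w x * ind (r x ≠ 0) = ∑ A ∈ E'.powerset, q A * (W A * ind (R A ≠ 0)) := by
    rw [← ex_att (fun A => W A * ind (R A ≠ 0))]
    exact expect_congr rfl fun x _ => by rw [hWw x, hrR x]
  rw [e1, e2]
  have hpt : ∀ A ∈ E'.powerset, q A * W A ≤ ∑ B ∈ T0.powerset,
      2 * (q (symmDiff A B) * (W (symmDiff A B) * ind (R (symmDiff A B) ≠ 0))) := by
    intro A hA
    rw [mem_powerset] at hA
    obtain ⟨B, hB, hRB⟩ := htog A
    have hnn : ∀ B ∈ T0.powerset,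
        0 ≤ 2 * (q (symmDiff A B) * (W (symmDiff A B) * ind (R (symmDiff A B) ≠ 0))) := by
      intro B hB
      have hqn : 0 ≤ q (symmDiff A B) := expect_nonneg fun x _ => ind_nonneg _
      have := hW0 (symmDiff A B)
      have := ind_nonneg (R (symmDiff A B) ≠ 0)
      positivity
    refine le_trans ?_ (single_le_sum hnn (mem_powerset.mpr hB))
    rw [ind_pos (by rw [hRB]; decide), mul_one, hWB A hA B hB, ← mul_assoc]
    refine mul_le_mul_of_nonneg_right ?_ (hW0 A)
    have h1 := (hqb A hA).2
    have h2 := (hqb _ (hsym A hA B hB)).1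
    linarith
  refine (sum_le_sum hpt).trans ?_
  rw [sum_comm]
  have hB : ∀ B ∈ T0.powerset, ∑ A ∈ E'.powerset,
      2 * (q (symmDiff A B) * (W (symmDiff A B) * ind (R (symmDiff A B) ≠ 0))) =
      2 * ∑ A ∈ E'.powerset, q A * (W A * ind (R A ≠ 0)) := by
    intro B hB
    rw [mem_powerset] at hB
    rw [mul_sum]
    refine sum_nbij' (fun A => symmDiff A B) (fun A => symmDiff A B) ?_ ?_ ?_ ?_ ?_
    · intro A hA; exact mem_powerset.mpr (hsym A (mem_powerset.mp hA) B hB)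
    · intro A hA; exact mem_powerset.mpr (hsym A (mem_powerset.mp hA) B hB)
    · intro A _; exact symmDiff_symmDiff_cancel_right _ _
    · intro A _; exact symmDiff_symmDiff_cancel_right _ _
    · intro A _; rfl
  rw [sum_congr rfl hB, sum_const, card_powerset, nsmul_eq_mul]
  have hS : 0 ≤ ∑ A ∈ E'.powerset, q A * (W A * ind (R A ≠ 0)) :=
    sum_nonneg fun A _ => mul_nonneg (expect_nonneg fun x _ => ind_nonneg _)
      (mul_nonneg (hW0 _) (ind_nonneg _))
  have h3 : (2 : ℝ) ^ T0.card ≤ 2 ^ Fintype.card ι :=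
    pow_le_pow_right₀ (by norm_num) (part_card (fun q hq => hE' q (hT0 hq)) hP0)
  push_cast
  rw [← mul_assoc, pow_succ]
  exact mul_le_mul_of_nonneg_right (by linarith) hS

end TP


namespace TP

open scoped BigOperators
open Function

set_option linter.unusedSectionVars false
set_option linter.unusedVariables false

variable {ι : Type} [Fintype ι] [DecidableEq ι] {n : ι → ℕ}

lemma anti_minor (f : ℕ → ℝ) (hf : ∀ k, 0 < f k) :
    ∃ g : ℕ → ℝ, (∀ k, 0 < g k) ∧ Antitone g ∧ ∀ k, g k ≤ f k := by
  refine ⟨fun k => Nat.rec (f 0) (fun k v => min v (f (k + 1))) k, ?_, ?_, ?_⟩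
  · intro k
    induction k with
    | zero => exact hf 0
    | succ k ih => exact lt_min ih (hf _)
  · exact antitone_nat_of_succ_le fun k => min_le_left _ _
  · intro k
    cases k with
    | zero => exact le_rfl
    | succ k => exact min_le_right _ _

lemma main_ind [Nonempty ι] (η : ℝ) (m : ℕ) : ∃ ψ : ℕ → ℝ, (∀ k, 0 < ψ k) ∧ Antitone ψ ∧
    ∃ C : ℕ → ℕ, ∀ (n : ι → ℕ) (B : Finset (XX n)) (E : Fm n) (Y : XX n → ℕ),
      Reg E (ψ E.card) → FactE E Y →
      (∃ F : Fm n, Fam F ∧ F.card ≤ C E.card ∧ ∀ r, IsForm univ r →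
        ∑ u ∈ B, ind (r u ≠ 0) ≤ η * B.card → r ∈ Idl F) ∨
      ∃ Y' : XX n → ℕ, ∑ u ∈ B, (Y' u : ℝ) ≤ ∑ u ∈ B, (Y u : ℝ) + m * (η * B.card) ∧
        𝔼 x, (1 / 2 : ℝ) ^ Y' x ≤
          (1 - (1 / 2) ^ (Fintype.card ι + 2)) ^ m * 𝔼 x, (1 / 2 : ℝ) ^ Y x := by
  classical
  induction m with
  | zero =>
    refine ⟨fun _ => 1, fun _ => one_pos, fun _ _ _ => le_rfl, fun _ => 0, ?_⟩
    intro n B E Y _ _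
    right
    exact ⟨Y, by simp, by simp⟩
  | succ m ih =>
    obtain ⟨ψ, hψ, hψa, C, hC⟩ := ih
    set D := Fintype.card ι with hD
    set Φ : ℕ → ℝ := fun N => min (ψ N) ((1 / 3 * (1 / 2) ^ N) ^ (2 ^ D)) with hΦ
    have hΦ0 : ∀ k, 0 < Φ k := fun k => lt_min (hψ k) (by positivity)
    have hΦa : Antitone Φ := by
      intro a b hab
      refine min_le_min (hψa hab) (pow_le_pow_left₀ (by positivity) ?_ _)
      have := pow_le_pow_of_le_one (a := (1 / 2 : ℝ)) (by norm_num) (by norm_num) hab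
      linarith
    have hSS := fun N => SS_every (ι := ι) (D + 1) 1 Φ hΦ0 hΦa (N + 1)
    choose C1 ψ1 hψ1 hS using hSS
    obtain ⟨ψ', hψ', hψ'a, hψ'l⟩ := anti_minor ψ1 hψ1
    refine ⟨ψ', hψ', hψ'a, fun N => max N ((range (C1 N + 1)).sup C), ?_⟩
    intro n B E Y hE hY
    by_cases hall : ∀ r, IsForm univ r → ∑ u ∈ B, ind (r u ≠ 0) ≤ η * B.card → r ∈ Idl E
    · left
      exact ⟨E, hE.1, le_max_left _ _, hall⟩
    push Not at hall
    obtain ⟨r, hr, hrB, hrE⟩ := hall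
    obtain ⟨E', hEE, hE'c, hE'r, hE'Q, -⟩ := hS E.card n E {(univ, r)} (by simp)
      (by intro q hq; rw [mem_singleton] at hq; subst hq; exact ⟨univ_nonempty, hr⟩)
      (by intro q hq; rw [mem_singleton] at hq; subst hq; simp [hD])
      (le_trans (card_filter_le _ _) (by simp)) (hE.mono (hψ'l _))
    have hrP : r ∈ TP.Poly E' univ := hE'Q (univ, r) (mem_singleton_self _)
    set Y1 : XX n → ℕ := fun x => Y x + (if r x = 0 then 0 else 1) with hY1
    have hY1E : FactE E' Y1 := by
      intro x y h
      simp only [hY1]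
      rw [hY x y fun p hp => h p (hEE hp), poly_fact hrP x y h]
    have hκ0 : (0 : ℝ) ≤ 1 / 3 * (1 / 2) ^ E'.card := by positivity
    have hK := lemK hEE hE'r.1 hκ0 le_rfl (reg_char hE'r hκ0 (min_le_right _ _)) hrP hrE
      (w := fun x => (1 / 2 : ℝ) ^ Y x) (fun x => by positivity)
      (fun x y h => by simp only; rw [hY x y h])
    have hstep : 𝔼 x, (1 / 2 : ℝ) ^ Y1 x ≤ (1 - (1 / 2) ^ (D + 2)) * 𝔼 x, (1 / 2 : ℝ) ^ Y x := by
      have e : 𝔼 x, (1 / 2 : ℝ) ^ Y1 x = 𝔼 x, (1 / 2 : ℝ) ^ Y x -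
          1 / 2 * 𝔼 x, (1 / 2 : ℝ) ^ Y x * ind (r x ≠ 0) := by
        rw [mul_expect, ← expect_sub_distrib]
        refine expect_congr rfl fun x _ => ?_
        simp only [hY1]
        by_cases h : r x = 0
        · rw [if_pos h, ind_neg (by simpa using h)]; simp
        · rw [if_neg h, ind_pos h, pow_succ]; ring
      rw [e]
      have h2 : (1 / 2 : ℝ) ^ (D + 2) * 2 ^ (D + 1) = 1 / 2 := by
        rw [one_div, inv_pow]; field_simp; ring
      have h3 := mul_le_mul_of_nonneg_left hK (show (0 : ℝ) ≤ (1 / 2) ^ (D + 2) by positivity)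
      rw [← mul_assoc, h2] at h3
      linarith
    have hsum : ∑ u ∈ B, (Y1 u : ℝ) ≤ ∑ u ∈ B, (Y u : ℝ) + η * B.card := by
      refine le_trans (le_of_eq ?_) (add_le_add_right hrB _)
      rw [← sum_add_distrib]
      refine sum_congr rfl fun x _ => ?_
      simp only [hY1]
      by_cases h : r x = 0
      · rw [if_pos h, ind_neg (by simpa using h)]; simp
      · rw [if_neg h, ind_pos h]; simp
    rcases hC n B E' Y1 (hE'r.mono (min_le_left _ _)) hY1E with ⟨F, hF, hFc, hFr⟩ | ⟨Y', h1, h2⟩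
    · left
      refine ⟨F, hF, hFc.trans (le_trans ?_ (le_max_right _ _)), hFr⟩
      exact le_sup (f := C) (mem_range.mpr (by omega))
    · right
      refine ⟨Y', ?_, ?_⟩
      · push_cast; linarith
      · refine h2.trans ?_
        rw [pow_succ (1 - (1 / 2 : ℝ) ^ (D + 2)) m, mul_assoc]
        refine mul_le_mul_of_nonneg_left hstep (pow_nonneg ?_ _)
        have : (1 / 2 : ℝ) ^ (D + 2) ≤ 1 := pow_le_one₀ (by norm_num) (by norm_num)
        linarith

lemma rho_bound (D : ℕ) : (1 - (1 / 2 : ℝ) ^ (D + 2)) ^ (2 ^ (D + 3)) ≤ 1 / 4 := by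
  have h1 : (1 / 2 : ℝ) ^ (D + 2) ≤ 1 := pow_le_one₀ (by norm_num) (by norm_num)
  have h0 : 1 - (1 / 2 : ℝ) ^ (D + 2) ≤ Real.exp (-(1 / 2) ^ (D + 2)) := by
    have := Real.add_one_le_exp (-(1 / 2 : ℝ) ^ (D + 2))
    linarith
  refine (pow_le_pow_left₀ (by linarith) h0 _).trans ?_
  rw [← Real.exp_nat_mul]
  have : ((2 ^ (D + 3) : ℕ) : ℝ) * (-(1 / 2) ^ (D + 2)) = -2 := by
    push_cast
    rw [one_div, inv_pow]; field_simp; ring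
  rw [this, Real.exp_neg]
  have h2 : (4 : ℝ) ≤ Real.exp 2 := by
    have h := Real.add_one_le_exp (1 : ℝ)
    have : Real.exp 2 = Real.exp 1 * Real.exp 1 := by rw [← Real.exp_add]; norm_num
    rw [this]; nlinarith
  rw [one_div]
  exact inv_anti₀ (by norm_num) h2

lemma main_thm [Nonempty ι] (δ : ℝ) (hδ : 0 < δ) : ∃ k : ℕ, ∀ (n : ι → ℕ) (B : Finset (XX n)),
    δ * Fintype.card (XX n) ≤ B.card → ∃ F : Fm n, Fam F ∧ F.card ≤ k ∧ ∀ r, IsForm univ r →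
      ∑ u ∈ B, ind (r u ≠ 0) ≤ (1 / 2) ^ (Fintype.card ι + 4) * B.card → r ∈ Idl F := by
  classical
  set D := Fintype.card ι with hD
  obtain ⟨l0, hl0⟩ := exists_pow_lt_of_lt_one (show 0 < δ / 2 by positivity)
    (show (1 / 2 : ℝ) < 1 by norm_num)
  set l := l0 + 1 with hl
  have hl1 : (1 / 2 : ℝ) ^ l < δ / 2 :=
    lt_of_le_of_lt (pow_le_pow_of_le_one (by norm_num) (by norm_num) (by omega)) hl0
  obtain ⟨ψ, hψ, -, C, hC⟩ := main_ind (ι := ι) ((1 / 2) ^ (D + 4)) (2 ^ (D + 3) * l)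
  refine ⟨C 0, fun n B hB => ?_⟩
  rcases hC n B ∅ (fun _ => 0) reg_empty (fun _ _ _ => rfl) with h | ⟨Y, h1, h2⟩
  · simpa using h
  exfalso
  have h1 : ∑ u ∈ B, (Y u : ℝ) ≤ l / 2 * B.card := by
    refine h1.trans (le_of_eq ?_)
    have : (2 : ℝ) ^ (D + 3) * (1 / 2) ^ (D + 4) = 1 / 2 := by
      rw [one_div, inv_pow]; field_simp; ring
    push_cast
    simp only [sum_const_zero, zero_add]
    calc _ = ((2 : ℝ) ^ (D + 3) * (1 / 2) ^ (D + 4)) * l * B.card := by push_cast; ring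
      _ = _ := by rw [this]; push_cast; ring
  have hlpos : (0 : ℝ) < l := by positivity
  have h3 : ∑ u ∈ B, ind (¬ Y u ≤ l) ≤ 1 / 2 * B.card := by
    have : ∑ u ∈ B, l * ind (¬ Y u ≤ l) ≤ ∑ u ∈ B, (Y u : ℝ) := by
      refine sum_le_sum fun u _ => ?_
      by_cases h : Y u ≤ l
      · rw [ind_neg (not_not.mpr h)]; simp
      · rw [ind_pos h, mul_one]; exact_mod_cast (not_le.mp h).le
    rw [← mul_sum] at this
    have h4 := this.trans h1
    have : (l : ℝ) / 2 * B.card = l * (1 / 2 * B.card) := by ring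
    rw [this] at h4
    exact le_of_mul_le_mul_left h4 hlpos
  have h4 : (1 / 2 : ℝ) ^ l * (1 / 2 * B.card) ≤ ∑ u, (1 / 2 : ℝ) ^ Y u := by
    have h5 : ∑ u ∈ B, (1 / 2 : ℝ) ^ l * (1 - ind (¬ Y u ≤ l)) ≤ ∑ u ∈ B, (1 / 2 : ℝ) ^ Y u := by
      refine sum_le_sum fun u _ => ?_
      by_cases h : Y u ≤ l
      · rw [ind_neg (not_not.mpr h), sub_zero, mul_one]
        exact pow_le_pow_of_le_one (by norm_num) (by norm_num) h
      · rw [ind_pos h]; simp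
    rw [← mul_sum, sum_sub_distrib, sum_const, nsmul_eq_mul, mul_one] at h5
    refine le_trans (mul_le_mul_of_nonneg_left (by linarith) (by positivity))
      (h5.trans (sum_le_sum_of_subset_of_nonneg (subset_univ _) fun u _ _ => by positivity))
  have h6 : 𝔼 x, (1 / 2 : ℝ) ^ Y x ≤ (1 / 4) ^ l := by
    refine h2.trans ?_
    rw [pow_mul]
    simp only [pow_zero]
    rw [expect_const univ_nonempty, mul_one]
    refine pow_le_pow_left₀ (pow_nonneg ?_ _) (rho_bound D) _
    have : (1 / 2 : ℝ) ^ (D + 2) ≤ 1 := pow_le_one₀ (by norm_num) (by norm_num)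
    linarith
  have hN : (0 : ℝ) < Fintype.card (XX n) := by exact_mod_cast Fintype.card_pos
  have h7 : ∑ u, (1 / 2 : ℝ) ^ Y u = Fintype.card (XX n) * 𝔼 x, (1 / 2 : ℝ) ^ Y x := by
    rw [← card_mul_expect, card_univ]
  rw [h7] at h4
  have h8 : (1 / 2 : ℝ) ^ l * (1 / 2 * (δ * Fintype.card (XX n))) ≤
      Fintype.card (XX n) * (1 / 4) ^ l := by
    refine le_trans (mul_le_mul_of_nonneg_left ?_ (by positivity))
      (h4.trans (mul_le_mul_of_nonneg_left h6 hN.le))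
    linarith
  have h9 : (1 / 4 : ℝ) ^ l = (1 / 2) ^ l * (1 / 2) ^ l := by rw [← mul_pow]; norm_num
  rw [h9] at h8
  have hp : (0 : ℝ) < (1 / 2) ^ l * Fintype.card (XX n) := by positivity
  have h10 : ((1 / 2 : ℝ) ^ l * Fintype.card (XX n)) * (δ / 2) ≤
      ((1 / 2 : ℝ) ^ l * Fintype.card (XX n)) * (1 / 2) ^ l := by linarith
  have := le_of_mul_le_mul_left h10 hp
  linarith

end TP


namespace TP

open scoped BigOperators
open Function

set_option linter.unusedSectionVars false
set_option linter.unusedVariables false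

variable {ι : Type} [Fintype ι] [DecidableEq ι] {n : ι → ℕ}

section fourier
variable {X : Type} [Fintype X] [DecidableEq X]

def pr (r a : X → ZMod 2) : ZMod 2 := ∑ x, r x * a x

lemma pr_add (r a b : X → ZMod 2) : pr r (a + b) = pr r a + pr r b := by
  simp only [pr, Pi.add_apply, mul_add, sum_add_distrib]

lemma pr_add_left (r s a : X → ZMod 2) : pr (r + s) a = pr r a + pr s a := by
  simp only [pr, Pi.add_apply, add_mul, sum_add_distrib]

lemma pr_zero (r : X → ZMod 2) : pr r 0 = 0 := by simp [pr]

lemma pr_single (x : X) (a : X → ZMod 2) : pr (Pi.single x 1) a = a x := by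
  rw [pr, sum_eq_single x]
  · simp
  · intro y _ h; simp [h]
  · simp

lemma orth (a : X → ZMod 2) : ∑ r : X → ZMod 2, sg (pr r a) =
    Fintype.card (X → ZMod 2) * ind (a = 0) := by
  by_cases h : a = 0
  · subst h
    rw [ind_pos rfl]
    simp [pr_zero, sg_zero]
  · rw [ind_neg h, mul_zero]
    obtain ⟨x, hx⟩ : ∃ x, a x ≠ 0 := by
      by_contra hc; push Not at hc; exact h (funext hc)
    have hx1 := (zmod2_cases (a x)).resolve_left hx
    have e : ∑ r : X → ZMod 2, sg (pr (r + Pi.single x 1) a) = ∑ r : X → ZMod 2, sg (pr r a) :=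
      Equiv.sum_comp (Equiv.addRight (Pi.single x 1 : X → ZMod 2)) (fun r => sg (pr r a))
    simp only [pr_add_left, pr_single, hx1, sg_add, sg_one, mul_neg, mul_one, sum_neg_distrib] at e
    linarith

lemma sg_ind (b : ZMod 2) : sg b = 1 - 2 * ind (b ≠ 0) := by
  rcases zmod2_cases b with rfl | rfl
  · rw [ind_neg (by simp), sg_zero]; ring
  · rw [ind_pos (by decide), sg_one]; ring

lemma fourier (A D0 : Finset (X → ZMod 2)) (hA : A.Nonempty) (h0 : 0 ∈ D0)
    (hadd : ∀ s ∈ D0, ∀ t ∈ D0, s + t ∈ D0) {β : Type} (B : Finset β) (hB : B.Nonempty)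
    (v : β → X → ZMod 2) (η : ℝ) (hη : 0 < η)
    (hR : ∀ r : X → ZMod 2, ∑ u ∈ B, ind (pr r (v u) ≠ 0) ≤ η * B.card → ∀ t ∈ D0, pr r t = 0)
    (hcl : (1 - η) * A.card * B.card ≤ ∑ u ∈ B, ∑ a ∈ A, ind (a + v u ∈ A)) :
    ∃ a ∈ A, 1 / 2 * (D0.card : ℝ) ≤ ∑ t ∈ D0, ind (a + t ∈ A) := by
  classical
  set G : ℝ := ((Fintype.card (X → ZMod 2) : ℕ) : ℝ) with hG
  have hGpos : 0 < G := by rw [hG]; exact_mod_cast Fintype.card_pos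
  have hBpos : (0 : ℝ) < B.card := by exact_mod_cast hB.card_pos
  have hDpos : (0 : ℝ) < D0.card := by exact_mod_cast card_pos.mpr ⟨0, h0⟩
  set fh : (X → ZMod 2) → ℝ := fun r => ∑ a ∈ A, sg (pr r a) with hfh
  set N : (X → ZMod 2) → ℝ := fun g => ∑ a ∈ A, ind (a + g ∈ A) with hN
  have h1 : ∀ g, ∑ r, fh r ^ 2 * sg (pr r g) = G * N g := by
    intro g
    have e1 : ∀ r, fh r ^ 2 * sg (pr r g) = ∑ a ∈ A, ∑ a' ∈ A, sg (pr r (a + a' + g)) := by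
      intro r
      rw [hfh, sq, sum_mul_sum, sum_mul]
      refine sum_congr rfl fun a _ => ?_
      rw [sum_mul]
      refine sum_congr rfl fun a' _ => ?_
      rw [pr_add, pr_add, sg_add, sg_add]
    rw [sum_congr rfl fun r _ => e1 r, sum_comm, hN, mul_sum]
    refine sum_congr rfl fun a _ => ?_
    rw [sum_comm]
    simp_rw [orth]
    rw [← mul_sum]
    congr 1
    by_cases h : a + g ∈ A
    · rw [ind_pos h, sum_eq_single (a + g)]
      · rw [ind_pos]
        have : a + (a + g) + g = (a + g) + (a + g) := by abel
        rw [this, fun_add_self]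
      · intro a' _ hne
        apply ind_neg
        intro h'
        apply hne
        have : a' = (a + a' + g) + (a + g) := by
          have : (a + a' + g) + (a + g) = a' + ((a + g) + (a + g)) := by abel
          rw [this, fun_add_self, add_zero]
        rw [this, h', zero_add]
      · intro h'; exact absurd h h'
    · rw [ind_neg h]
      refine sum_eq_zero fun a' ha' => ind_neg fun h' => h ?_
      have : a + g = (a + a' + g) + a' := by
        have : (a + a' + g) + a' = (a + g) + (a' + a') := by abel
        rw [this, fun_add_self, add_zero]
      rw [this, h', zero_add]; exact ha'
  have hN0 : N 0 = A.card := by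
    rw [hN]
    simp only [add_zero]
    rw [sum_congr rfl fun a ha => ind_pos ha]
    simp
  have hpars : ∑ r, fh r ^ 2 = G * A.card := by
    rw [← hN0, ← h1]
    exact sum_congr rfl fun r _ => by rw [pr_zero, sg_zero, mul_one]
  set Rn : (X → ZMod 2) → Prop := fun r => ¬ ∑ u ∈ B, ind (pr r (v u) ≠ 0) ≤ η * B.card with hRn
  have h3 : ∑ r, fh r ^ 2 * ind (Rn r) ≤ 1 / 2 * (G * A.card) := by
    have e1 : ∑ r, fh r ^ 2 * (B.card - 2 * ∑ u ∈ B, ind (pr r (v u) ≠ 0)) =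
        G * ∑ u ∈ B, N (v u) := by
      rw [mul_sum, sum_congr rfl fun u _ => (h1 (v u)).symm, sum_comm]
      refine sum_congr rfl fun r _ => ?_
      rw [← mul_sum]
      congr 1
      simp_rw [sg_ind]
      rw [sum_sub_distrib, ← mul_sum]; simp
    have e2 : ∑ r, fh r ^ 2 * (B.card - 2 * ∑ u ∈ B, ind (pr r (v u) ≠ 0)) ≤
        ∑ r, (fh r ^ 2 * B.card - 2 * (η * B.card) * (fh r ^ 2 * ind (Rn r))) := by
      refine sum_le_sum fun r _ => ?_
      have hp : η * B.card * ind (Rn r) ≤ ∑ u ∈ B, ind (pr r (v u) ≠ 0) := by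
        by_cases h : Rn r
        · rw [ind_pos h, mul_one]; exact (not_le.mp h).le
        · rw [ind_neg h, mul_zero]; exact sum_nonneg fun u _ => ind_nonneg _
      have hf := sq_nonneg (fh r)
      nlinarith [mul_le_mul_of_nonneg_left hp hf]
    rw [e1, sum_sub_distrib, ← mul_sum, ← sum_mul, hpars] at e2
    have e3 : G * ((1 - η) * A.card * B.card) ≤ G * ∑ u ∈ B, N (v u) :=
      mul_le_mul_of_nonneg_left hcl hGpos.le
    have e4 : (2 * (η * B.card)) * ∑ r, fh r ^ 2 * ind (Rn r) ≤
        (2 * (η * B.card)) * (1 / 2 * (G * A.card)) := by nlinarith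
    exact le_of_mul_le_mul_left e4 (by positivity)
  set S : (X → ZMod 2) → ℝ := fun r => ∑ t ∈ D0, sg (pr r t) with hS
  have hS0 : ∀ r, 0 ≤ S r := by
    intro r
    have : S r * S r = D0.card * S r := by
      have : ∀ s ∈ D0, ∑ t ∈ D0, sg (pr r s) * sg (pr r t) = S r := by
        intro s hs
        rw [hS]
        refine sum_nbij' (fun t => s + t) (fun t => s + t) (fun t ht => hadd s hs t ht)
          (fun t ht => hadd s hs t ht) ?_ ?_ ?_
        · intro t _; rw [← add_assoc, fun_add_self, zero_add]
        · intro t _; rw [← add_assoc, fun_add_self, zero_add]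
        · intro t _; rw [pr_add, sg_add]
      calc S r * S r = ∑ s ∈ D0, ∑ t ∈ D0, sg (pr r s) * sg (pr r t) := sum_mul_sum _ _ _ _
        _ = _ := by rw [sum_congr rfl this]; simp
    have h2 := mul_self_nonneg (S r)
    rw [this] at h2
    exact nonneg_of_mul_nonneg_right h2 hDpos
  have hS1 : ∀ r, D0.card * (1 - ind (Rn r)) ≤ S r := by
    intro r
    by_cases h : Rn r
    · rw [ind_pos h, sub_self, mul_zero]; exact hS0 r
    · rw [ind_neg h, sub_zero, mul_one, hS]
      have := hR r (not_not.mp h)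
      simp only
      rw [sum_congr rfl fun t ht => by rw [this t ht, sg_zero]]
      simp
  have h4 : G * ∑ t ∈ D0, N t = ∑ r, fh r ^ 2 * S r := by
    rw [mul_sum, sum_congr rfl fun t _ => (h1 t).symm, sum_comm]
    exact sum_congr rfl fun r _ => by rw [← mul_sum]
  have h5 : D0.card * (1 / 2 * (G * A.card)) ≤ ∑ r, fh r ^ 2 * S r := by
    calc D0.card * (1 / 2 * (G * A.card))
        ≤ D0.card * (∑ r, fh r ^ 2 - ∑ r, fh r ^ 2 * ind (Rn r)) := by
          refine mul_le_mul_of_nonneg_left ?_ hDpos.le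
          rw [hpars]; linarith
      _ = ∑ r, fh r ^ 2 * (D0.card * (1 - ind (Rn r))) := by
          rw [← sum_sub_distrib, mul_sum]
          exact sum_congr rfl fun r _ => by ring
      _ ≤ _ := sum_le_sum fun r _ => mul_le_mul_of_nonneg_left (hS1 r) (sq_nonneg _)
  rw [← h4] at h5
  have h6 : ∑ a ∈ A, 1 / 2 * (D0.card : ℝ) ≤ ∑ a ∈ A, ∑ t ∈ D0, ind (a + t ∈ A) := by
    rw [sum_comm, sum_const, nsmul_eq_mul]
    have : G * (A.card * (1 / 2 * (D0.card : ℝ))) ≤ G * ∑ t ∈ D0, N t := by linarith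
    exact le_of_mul_le_mul_left this hGpos
  exact exists_le_of_sum_le hA h6

end fourier

end TP


namespace TP

open scoped BigOperators
open Function

set_option linter.unusedSectionVars false
set_option linter.unusedVariables false

variable {ι : Type} [Fintype ι] [DecidableEq ι] {n : ι → ℕ}

section fin
variable {d : ℕ} {m : Fin d → ℕ}

lemma tensor_form (r : Arr d m) :
    IsForm (n := m) univ (fun u => pr r (tensorOf d m u)) := by
  constructor
  · intro x y h
    have : x = y := funext fun i => h i (mem_univ i)
    rw [this]
  · intro i _ x a b
    rw [← pr_add]
    congr 1
    funext z
    simp only [tensorOf, Pi.add_apply]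
    rw [← mul_prod_erase _ _ (mem_univ i), ← mul_prod_erase _ _ (mem_univ i),
      ← mul_prod_erase _ _ (mem_univ i)]
    simp only [update_self, Pi.add_apply]
    have : ∀ t : Fin (m i) → ZMod 2, ∏ j ∈ univ.erase i, update x i t j (z j) =
        ∏ j ∈ univ.erase i, x j (z j) := by
      intro t
      refine prod_congr rfl fun j hj => ?_
      rw [update_of_ne (mem_erase.mp hj).1]
    rw [this, this, this, add_mul]

def ee (x : (i : Fin d) → Fin (m i)) : XX m := fun i => Pi.single (x i) 1

lemma pr_ee (r : Arr d m) (x : (i : Fin d) → Fin (m i)) : pr r (tensorOf d m (ee x)) = r x := by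
  rw [pr, sum_eq_single x]
  · simp [tensorOf, ee]
  · intro y _ hne
    obtain ⟨i, hi⟩ : ∃ i, y i ≠ x i := by
      by_contra hc; push Not at hc; exact hne (funext hc)
    have : tensorOf d m (ee x) y = 0 := prod_eq_zero (mem_univ i) (by simp [ee, hi])
    rw [this, mul_zero]
  · simp

def ext1 (I : Finset (Fin d)) (y : (i : {x : Fin d // x ∈ I}) → Fin (m i.1)) : XX m :=
  fun i => if h : i ∈ I then Pi.single (y ⟨i, h⟩) 1 else 0

def ext2 (I : Finset (Fin d)) (z : (i : {x : Fin d // x ∉ I}) → Fin (m i.1)) : XX m :=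
  fun i => if h : i ∈ I then 0 else Pi.single (z ⟨i, h⟩) 1

/-- the linear functionals -/
noncomputable def LL (F : Fm m) (I : Finset (Fin d)) :
    F2I d m I →ₗ[ZMod 2] ({p // p ∈ F} → ZMod 2) where
  toFun s := fun p => if p.1.1 = I then ∑ y, p.1.2 (ext1 I y) * s y else 0
  map_add' s t := by
    funext p
    by_cases h : p.1.1 = I
    · simp only [h, if_true, Pi.add_apply, mul_add, sum_add_distrib]
    · simp [h]
  map_smul' c s := by
    funext p
    by_cases h : p.1.1 = I
    · simp only [h, if_true, Pi.smul_apply, RingHom.id_apply, smul_eq_mul, mul_sum]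
      exact sum_congr rfl fun y _ => by ring
    · simp [h]

lemma LL_codim (F : Fm m) (I : Finset (Fin d)) :
    Module.finrank (ZMod 2) (F2I d m I) - Module.finrank (ZMod 2) (LinearMap.ker (LL F I)) ≤
      F.card := by
  have h := LinearMap.finrank_range_add_finrank_ker (LL F I)
  have h2 : Module.finrank (ZMod 2) (LinearMap.range (LL F I)) ≤ F.card := by
    refine (Submodule.finrank_le _).trans ?_
    simp
  omega

lemma idl_perp {F : Fm m} (hF : Fam F) {r : Arr d m}
    (hr : (fun u => pr r (tensorOf d m u)) ∈ Idl (n := m) F) {t : Arr d m}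
    (ht : ∀ I : Finset (Fin d), I.Nonempty → t ∈ cylSub d m I (LinearMap.ker (LL F I))) :
    pr r t = 0 := by
  obtain ⟨g, hg, hrg⟩ := hr
  have hrx : ∀ x, r x = ∑ p ∈ F, p.2 (ee x) * g p (ee x) := by
    intro x
    rw [← pr_ee r x]
    have := congrFun hrg (ee x)
    simpa [Finset.sum_apply] using this
  rw [pr]
  simp_rw [hrx, sum_mul]
  rw [sum_comm]
  refine sum_eq_zero fun p hp => ?_
  obtain ⟨hne, hpf⟩ := hF p hp
  rw [← Equiv.sum_comp (Equiv.piEquivPiSubtypeProd (fun i => i ∈ p.1) (fun i => Fin (m i))).symm,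
    Fintype.sum_prod_type, sum_comm]
  refine sum_eq_zero fun z _ => ?_
  have hk := ht p.1 hne z
  rw [LinearMap.mem_ker] at hk
  have hk := congrFun hk ⟨p, hp⟩
  simp only [LL, LinearMap.coe_mk, AddHom.coe_mk, if_true, Pi.zero_apply] at hk
  have : ∀ y : (i : {x : Fin d // x ∈ p.1}) → Fin (m i.1),
      p.2 (ee ((Equiv.piEquivPiSubtypeProd (fun i => i ∈ p.1) (fun i => Fin (m i))).symm (y, z))) *
      g p (ee ((Equiv.piEquivPiSubtypeProd (fun i => i ∈ p.1) (fun i => Fin (m i))).symm (y, z))) *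
      t ((Equiv.piEquivPiSubtypeProd (fun i => i ∈ p.1) (fun i => Fin (m i))).symm (y, z)) =
      g p (ext2 p.1 z) * (p.2 (ext1 p.1 y) * arrSlice d m p.1 t z y) := by
    intro y
    have e1 : p.2 (ee ((Equiv.piEquivPiSubtypeProd (fun i => i ∈ p.1)
        (fun i => Fin (m i))).symm (y, z))) = p.2 (ext1 p.1 y) := by
      apply hpf.dep
      intro i hi
      simp [ee, ext1, hi, Equiv.piEquivPiSubtypeProd]
    have e2 : g p (ee ((Equiv.piEquivPiSubtypeProd (fun i => i ∈ p.1)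
        (fun i => Fin (m i))).symm (y, z))) = g p (ext2 p.1 z) := by
      apply hg p hp
      intro i hi
      simp [ee, ext2, hi, Equiv.piEquivPiSubtypeProd]
    have e3 : t ((Equiv.piEquivPiSubtypeProd (fun i => i ∈ p.1)
        (fun i => Fin (m i))).symm (y, z)) = arrSlice d m p.1 t z y := rfl
    rw [e1, e2, e3]; ring
  rw [sum_congr rfl fun y _ => this y, ← mul_sum, hk, mul_zero]

end fin

end TP

theorem stmt5 (d : ℕ) (hd : 0 < d) :
    ∃ ε : ℝ, 0 < ε ∧ ∀ δ : ℝ, 0 < δ → ∃ k : ℕ, 0 < k ∧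
      ∀ n : Fin d → ℕ, (∀ i, 0 < n i) →
        ∀ B' : Finset (Tup d n), δ * 2 ^ (∑ i, n i) ≤ (B'.card : ℝ) →
          ∀ A : Finset (Arr d n), A.Nonempty →
            ((1 - ε) * A.card * B'.card ≤ (closedCnt d n A B' : ℝ)) →
            ∃ D : Set (Arr d n), IsKSimple d n k D ∧
              (1 / 2 : ℝ) * D.ncard ≤ ((D ∩ ↑A).ncard : ℝ) := by
  classical
  haveI : Nonempty (Fin d) := ⟨⟨0, hd⟩⟩
  refine ⟨(1 / 2) ^ (Fintype.card (Fin d) + 4), by positivity, fun δ hδ => ?_⟩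
  obtain ⟨k, hk⟩ := TP.main_thm (ι := Fin d) δ hδ
  refine ⟨max 1 k, by simp, fun n _ B' hB' A hA hcl => ?_⟩
  have hcard : (Fintype.card (TP.XX n) : ℝ) = 2 ^ (∑ i, n i) := by
    rw [Fintype.card_pi]
    push_cast
    rw [← Finset.prod_pow_eq_pow_sum]
    refine Finset.prod_congr rfl fun i _ => ?_
    rw [Fintype.card_fun, ZMod.card, Fintype.card_fin]; push_cast; rfl
  obtain ⟨F, hF, hFk, hFr⟩ := hk n B' (by rw [hcard]; exact hB')
  have hBne : B'.Nonempty := by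
    rw [← Finset.card_pos]
    have : (0 : ℝ) < δ * 2 ^ (∑ i, n i) := by positivity
    exact_mod_cast lt_of_lt_of_le this hB'
  set P : Arr d n → Prop := fun t => ∀ I : Finset (Fin d), I.Nonempty →
    t ∈ cylSub d n I (LinearMap.ker (TP.LL F I)) with hP
  set D0 : Finset (Arr d n) := Finset.univ.filter P with hD0
  have hcl2 : (closedCnt d n A B' : ℝ) =
      ∑ u ∈ B', ∑ a ∈ A, TP.ind (a + tensorOf d n u ∈ A) := by
    rw [closedCnt, Finset.card_filter, Finset.sum_product_right]
    push_cast
    refine Finset.sum_congr rfl fun u _ => Finset.sum_congr rfl fun a _ => ?_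
    rw [TP.ind_ite]
  rw [hcl2] at hcl
  obtain ⟨a, haA, ha⟩ := TP.fourier A D0 hA
    (Finset.mem_filter.mpr ⟨Finset.mem_univ _, fun I _ => Submodule.zero_mem _⟩)
    (fun s hs t ht => Finset.mem_filter.mpr ⟨Finset.mem_univ _, fun I hI =>
      Submodule.add_mem _ ((Finset.mem_filter.mp hs).2 I hI) ((Finset.mem_filter.mp ht).2 I hI)⟩)
    B' hBne (tensorOf d n) ((1 / 2) ^ (Fintype.card (Fin d) + 4)) (by positivity)
    (fun r hr t ht => TP.idl_perp hF (hFr _ (TP.tensor_form r) hr) (Finset.mem_filter.mp ht).2) hcl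
  have hDset : {x | ∃ r : Arr d n, (∀ I : Finset (Fin d), I.Nonempty →
      r ∈ cylSub d n I (LinearMap.ker (TP.LL F I))) ∧ x = a + r} =
      ((D0.image (fun t => a + t) : Finset (Arr d n)) : Set (Arr d n)) := by
    ext x
    simp only [Set.mem_setOf_eq, Finset.coe_image, Set.mem_image, Finset.mem_coe, hD0,
      Finset.mem_filter, Finset.mem_univ, true_and]
    constructor
    · rintro ⟨r, h1, h2⟩; exact ⟨r, h1, h2.symm⟩
    · rintro ⟨r, h1, h2⟩; exact ⟨r, h1, h2.symm⟩
  refine ⟨_, ⟨a, fun I => LinearMap.ker (TP.LL F I), fun I _ => (TP.LL_codim F I).trans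
    (hFk.trans (le_max_right _ _)), rfl⟩, ?_⟩
  rw [hDset]
  have hinj : Function.Injective (fun t : Arr d n => a + t) := add_right_injective a
  rw [Set.ncard_coe_finset, Finset.card_image_of_injective _ hinj, ← Finset.coe_inter,
    Set.ncard_coe_finset]
  refine ha.trans (le_of_eq ?_)
  have : D0.image (fun t => a + t) ∩ A = (D0.filter (fun t => a + t ∈ A)).image (fun t => a + t) := by
    ext x
    simp only [Finset.mem_inter, Finset.mem_image, Finset.mem_filter]
    constructor
    · rintro ⟨⟨t, h1, rfl⟩, h2⟩; exact ⟨t, ⟨h1, h2⟩, rfl⟩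
    · rintro ⟨t, ⟨h1, h2⟩, rfl⟩; exact ⟨⟨t, h1, rfl⟩, h2⟩
  rw [this, Finset.card_image_of_injective _ hinj, Finset.card_filter]
  push_cast
  exact Finset.sum_congr rfl fun t _ => by rw [TP.ind_ite]
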